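/- Let d ≥ 1, and adopt the stochastic Fourier advection–diffusion setup with diffusivity ν ∈ (0, e^{−1}], initial data g, mixing constants K ≥ 1, γ > 0, and asymptotic mass measure m. Let q ≥ 2, p ≥ 2, define W_t := Σ_{k∈ℤ^d} (1+|k|)^q |v_t(k)|, and suppose that almost surely t ↦ W_t is locally integrable and that 𝔼 W_t^p ≤ 𝔼 W_0^p < ∞ for all t ≥ 0. Then there is a constant C ≥ 2, depending only on d, K, γ, and N₀, such that for every h ≥ 1, every R with max(C, h) ≤ R ≤ ν^{−1/2} / (C (log ν^{−1})^{1/2}), and every α > 0: μ_{N₀,R}( { r ∈ [h, R] : m([r, r+h]) ≤ α h / r } ) ≤ C^q h^{2−q} α^{−1} + C^{p+q} (𝔼 W_0^p) α^{p−1}. -/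

import Mathlib

open MeasureTheory ENNReal Real Set
open scoped Classical

noncomputable section

/-- Euclidean norm of a lattice point `k ∈ ℤ^d`. -/
def znorm {d : ℕ} (k : Fin d → ℤ) : ℝ := Real.sqrt (∑ i, ((k i : ℝ)) ^ 2)

/-- Euclidean norm of a vector in `ℂ^d`. -/
def cnorm {d : ℕ} (z : Fin d → ℂ) : ℝ := Real.sqrt (∑ i, ‖z i‖ ^ 2)

/-- Pairing `k · z = Σ_i k_i z_i`. -/
def zdot {d : ℕ} (k : Fin d → ℤ) (z : Fin d → ℂ) : ℂ := ∑ i, (k i : ℂ) * z i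

/-- Divergence-free in Fourier variables: `k · v(k) = 0` for all `k`. -/
def DivFree {d : ℕ} (v : (Fin d → ℤ) → Fin d → ℂ) : Prop := ∀ k, zdot k (v k) = 0

/-- Fourier coefficients of a real vector field: `v(-k) = conj (v k)`. -/
def RealCoeff {d : ℕ} (v : (Fin d → ℤ) → Fin d → ℂ) : Prop :=
  ∀ k i, v (-k) i = starRingEnd ℂ (v k i)

/-- A weight: nondecreasing on `[0,∞)` with values in `[1,∞]`. -/
def IsWeight (w : ℝ → ℝ≥0∞) : Prop :=
  MonotoneOn w (Set.Ici 0) ∧ ∀ s, 0 ≤ s → 1 ≤ w s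

/-- Weighted ℓ¹ norm `‖w v‖_{ℓ¹} = Σ_k w(|k|)|v(k)|`. -/
def wl1 {d : ℕ} (w : ℝ → ℝ≥0∞) (v : (Fin d → ℤ) → Fin d → ℂ) : ℝ≥0∞ :=
  ∑' k, w (znorm k) * ENNReal.ofReal (cnorm (v k))

/-- `(w⁻¹ * m_a)(r) = Σ_k w(||k|-r|)⁻¹ |a(k)|²`. -/
def convMass {d : ℕ} (w : ℝ → ℝ≥0∞) (a : (Fin d → ℤ) → ℂ) (r : ℝ) : ℝ≥0∞ :=
  ∑' k, (w |znorm k - r|)⁻¹ * (‖a k‖₊ : ℝ≥0∞) ^ 2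

/-- `m_a(E) = Σ_{|k| ∈ E} |a(k)|²`. -/
def massOn {d : ℕ} (a : (Fin d → ℤ) → ℂ) (E : Set ℝ) : ℝ≥0∞ :=
  ∑' k, if znorm k ∈ E then (‖a k‖₊ : ℝ≥0∞) ^ 2 else 0

/-- Logarithmic density measure `μ_{a,b}(E)`. -/
def logDensity (a b : ℝ) (E : Set ℝ) : ℝ≥0∞ :=
  (ENNReal.ofReal (Real.log (b / a)))⁻¹ * ∫⁻ r in E ∩ Set.Icc a b, ENNReal.ofReal r⁻¹

/-- The right-hand side of the Fourier advection–diffusion system. -/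
def fourierRHS {d : ℕ} (ν : ℝ) (v : (Fin d → ℤ) → Fin d → ℂ) (a : (Fin d → ℤ) → ℂ)
    (k : Fin d → ℤ) : ℂ :=
  Complex.ofReal (-(4 * π ^ 2 * ν * znorm k ^ 2)) * a k
    - 2 * Complex.ofReal π * Complex.I * ∑' j, zdot k (v (k - j)) * a j


/-- The asymptotic mass measure `m(E) = 𝔼 ∫_0^∞ m_{a_t}(E) dt`. -/
def asymMass {d : ℕ} {Ω : Type*} [MeasurableSpace Ω] (ℙ : Measure Ω)
    (a : Ω → ℝ → (Fin d → ℤ) → ℂ) (E : Set ℝ) : ℝ≥0∞ :=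
  ∫⁻ ω, (∫⁻ t in Set.Ici (0 : ℝ), massOn (a ω t) E) ∂ℙ

/-- The stochastic Fourier advection–diffusion setup: measurability, a divergence-free
real velocity, initial data `g` of unit mass and zero mean, the Fourier-coefficient
advection–diffusion ODE, rapid decrease locally uniformly in time, and the
uniform-in-diffusivity exponential mixing bound. -/
def AdvectionSetup {d : ℕ} {Ω : Type*} [MeasurableSpace Ω] (ℙ : Measure Ω) (ν K γ : ℝ)
    (v : Ω → ℝ → (Fin d → ℤ) → Fin d → ℂ) (a : Ω → ℝ → (Fin d → ℤ) → ℂ)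
    (g : (Fin d → ℤ) → ℂ) : Prop :=
  (∀ k : Fin d → ℤ, Measurable fun p : Ω × ℝ => a p.1 p.2 k) ∧
  (∀ (k : Fin d → ℤ) (i : Fin d), Measurable fun p : Ω × ℝ => v p.1 p.2 k i) ∧
  g 0 = 0 ∧
  (∑' k : Fin d → ℤ, (‖g k‖₊ : ℝ≥0∞) ^ 2) = 1 ∧
  (∀ᵐ ω ∂ℙ,
    (∀ t : ℝ, 0 ≤ t → DivFree (v ω t) ∧ RealCoeff (v ω t)) ∧
    a ω 0 = g ∧
    (∀ (k : Fin d → ℤ), ∀ t ∈ Set.Ici (0 : ℝ),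
      HasDerivWithinAt (fun s => a ω s k) (fourierRHS ν (v ω t) (a ω t) k) (Set.Ici 0) t) ∧
    (∀ N : ℕ, ∀ T > (0 : ℝ), ∃ M : ℝ, ∀ t ∈ Set.Icc (0 : ℝ) T,
      ∑' k : Fin d → ℤ, ENNReal.ofReal ((1 + znorm k) ^ N) * (‖a ω t k‖₊ : ℝ≥0∞) ^ 2
        ≤ ENNReal.ofReal M)) ∧
  (∀ t : ℝ, 0 ≤ t →
    (∫⁻ ω, (∑' k : Fin d → ℤ, if k = 0 then 0 else
        (ENNReal.ofReal ((2 * π * znorm k) ^ 2))⁻¹ * (‖a ω t k‖₊ : ℝ≥0∞) ^ 2) ∂ℙ)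
      ≤ ENNReal.ofReal (K * Real.exp (-γ * t)))

theorem znorm_eq_norm {d : ℕ} (k : Fin d → ℤ) :
    znorm k = ‖WithLp.toLp 2 (fun i => (k i : ℝ))‖ := by
  simp [znorm, EuclideanSpace.norm_eq]

theorem znorm_nonneg {d : ℕ} (k : Fin d → ℤ) : 0 ≤ znorm k := Real.sqrt_nonneg _

theorem cnorm_nonneg {d : ℕ} (z : Fin d → ℂ) : 0 ≤ cnorm z := Real.sqrt_nonneg _

theorem abs_znorm_sub_le {d : ℕ} (k j : Fin d → ℤ) : |znorm k - znorm j| ≤ znorm (k - j) := by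
  simp only [znorm_eq_norm]
  refine (abs_norm_sub_norm_le _ _).trans (le_of_eq ?_)
  congr 1
  ext i
  simp

theorem norm_zdot_le {d : ℕ} (k : Fin d → ℤ) (z : Fin d → ℂ) :
    ‖zdot k z‖ ≤ znorm k * cnorm z := by
  unfold zdot znorm cnorm
  calc ‖∑ i, (k i : ℂ) * z i‖ ≤ ∑ i, ‖(k i : ℂ) * z i‖ := norm_sum_le _ _
    _ = ∑ i, |(k i : ℝ)| * ‖z i‖ := by
        refine Finset.sum_congr rfl fun i _ => ?_
        rw [norm_mul, Complex.norm_intCast]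
    _ ≤ Real.sqrt (∑ i, |(k i : ℝ)| ^ 2) * Real.sqrt (∑ i, ‖z i‖ ^ 2) :=
        Real.sum_mul_le_sqrt_mul_sqrt _ _ _
    _ = _ := by simp only [sq_abs]

theorem abs_apply_le_znorm {d : ℕ} (k : Fin d → ℤ) (i : Fin d) : |(k i : ℝ)| ≤ znorm k := by
  unfold znorm
  rw [← Real.sqrt_sq_eq_abs]
  exact Real.sqrt_le_sqrt
    (Finset.single_le_sum (f := fun i => (k i : ℝ) ^ 2) (fun _ _ => sq_nonneg _)
      (Finset.mem_univ i))

theorem finite_znorm_lt (d : ℕ) (r : ℝ) : {k : Fin d → ℤ | znorm k < r}.Finite := by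
  refine (Set.finite_Icc (fun _ : Fin d => -⌈r⌉) (fun _ => ⌈r⌉)).subset fun k hk => ?_
  have h : ∀ i, |(k i : ℝ)| ≤ (⌈r⌉ : ℝ) := fun i =>
    (abs_apply_le_znorm k i).trans ((le_of_lt hk).trans (Int.le_ceil r))
  constructor <;> intro i <;> have := abs_le.1 (h i)
  · exact_mod_cast this.1
  · exact_mod_cast this.2

theorem one_le_znorm {d : ℕ} {k : Fin d → ℤ} (hk : k ≠ 0) : 1 ≤ znorm k := by
  obtain ⟨i, hi⟩ := Function.ne_iff.1 hk
  refine le_trans ?_ (abs_apply_le_znorm k i)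
  exact_mod_cast Int.one_le_abs hi

/-- The lattice points of norm less than `r`. -/
def zball (d : ℕ) (r : ℝ) : Finset (Fin d → ℤ) := (finite_znorm_lt d r).toFinset

theorem mem_zball {d : ℕ} {r : ℝ} {k : Fin d → ℤ} : k ∈ zball d r ↔ znorm k < r := by
  simp [zball]

/-- The polynomially weighted `ℓ¹` norm `Σ_k (1 + |k|)^q |v(k)|`. -/
def polyNorm {d : ℕ} (q : ℝ) (v : (Fin d → ℤ) → Fin d → ℂ) : ℝ≥0∞ :=
  ∑' k : Fin d → ℤ, ENNReal.ofReal ((1 + znorm k) ^ q * cnorm (v k))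

/-- The kernel `(1 + |s|)^(-q)`. -/
def decay (q s : ℝ) : ℝ≥0∞ := ENNReal.ofReal ((1 + |s|) ^ (-q))

/-- The mass of `a` seen from radius `r` through the kernel `decay q`. -/
def polyMass {d : ℕ} (q : ℝ) (a : (Fin d → ℤ) → ℂ) (r : ℝ) : ℝ≥0∞ :=
  ∑' k, decay q (znorm k - r) * (‖a k‖₊ : ℝ≥0∞) ^ 2

theorem cross_term_le {c x y n s t q : ℝ} (hc : 0 ≤ c) (hx : 0 ≤ x) (hy : 0 ≤ y)
    (hq : 0 ≤ q) (hn : |s| + |t| ≤ n) :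
    c * x * y ≤ 1 / 2 * ((1 + n) ^ q * c * ((1 + |s|) ^ (-q) * x ^ 2)) +
      1 / 2 * ((1 + n) ^ q * c * ((1 + |t|) ^ (-q) * y ^ 2)) := by
  have hs := abs_nonneg s
  have ht := abs_nonneg t
  have hs1 : 0 < 1 + |s| := by linarith
  have ht1 : 0 < 1 + |t| := by linarith
  have h1 : (1 + |s|) ^ (q / 2) * (1 + |t|) ^ (q / 2) ≤ (1 + n) ^ q := by
    calc (1 + |s|) ^ (q / 2) * (1 + |t|) ^ (q / 2)
        ≤ (1 + n) ^ (q / 2) * (1 + n) ^ (q / 2) := by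
          have : 0 ≤ 1 + n := by linarith
          gcongr <;> linarith
      _ = (1 + n) ^ q := by
          rw [← Real.rpow_add (by linarith)]; congr 1; ring
  set u := (1 + |s|) ^ (-(q / 2)) with hu
  set w := (1 + |t|) ^ (-(q / 2)) with hw
  have hu0 : 0 ≤ u := by positivity
  have hw0 : 0 ≤ w := by positivity
  have hu2 : (1 + |s|) ^ (-q) = u ^ 2 := by
    rw [hu, ← Real.rpow_natCast, ← Real.rpow_mul hs1.le]; congr 1; push_cast; ring
  have hw2 : (1 + |t|) ^ (-q) = w ^ 2 := by
    rw [hw, ← Real.rpow_natCast, ← Real.rpow_mul ht1.le]; congr 1; push_cast; ring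
  have h2 : 1 ≤ (1 + n) ^ q * (u * w) := by
    have : (1 + |s|) ^ (q / 2) * (1 + |t|) ^ (q / 2) * (u * w) = 1 := by
      have e1 : (1 + |s|) ^ (q / 2) * u = 1 := by
        rw [hu, ← Real.rpow_add hs1]; simp
      have e2 : (1 + |t|) ^ (q / 2) * w = 1 := by
        rw [hw, ← Real.rpow_add ht1]; simp
      calc _ = ((1 + |s|) ^ (q / 2) * u) * ((1 + |t|) ^ (q / 2) * w) := by ring
        _ = 1 := by rw [e1, e2, one_mul]
    calc (1 : ℝ) = _ := this.symm
      _ ≤ _ := by gcongr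
  rw [hu2, hw2]
  have hA : 0 ≤ (1 + n) ^ q := Real.rpow_nonneg (by linarith) _
  calc c * x * y = c * x * y * 1 := by ring
    _ ≤ c * x * y * ((1 + n) ^ q * (u * w)) := by gcongr
    _ = (1 + n) ^ q * c * ((u * x) * (w * y)) := by ring
    _ ≤ (1 + n) ^ q * c * (1 / 2 * (u * x) ^ 2 + 1 / 2 * (w * y) ^ 2) := by
        gcongr
        nlinarith [sq_nonneg (u * x - w * y)]
    _ = _ := by ring

theorem tsum_sub_mul {d : ℕ} (u f : (Fin d → ℤ) → ℝ≥0∞) :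
    ∑' (k : Fin d → ℤ) (j : Fin d → ℤ), u (k - j) * f k = (∑' k, u k) * ∑' k, f k := by
  simp_rw [ENNReal.tsum_mul_right]
  rw [← ENNReal.tsum_mul_left]
  refine tsum_congr fun k => ?_
  rw [← (Equiv.subLeft k).tsum_eq u]
  rfl

theorem tsum_sub_mul' {d : ℕ} (u f : (Fin d → ℤ) → ℝ≥0∞) :
    ∑' (k : Fin d → ℤ) (j : Fin d → ℤ), u (k - j) * f j = (∑' k, u k) * ∑' k, f k := by
  rw [ENNReal.tsum_comm]
  simp_rw [ENNReal.tsum_mul_right]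
  rw [← ENNReal.tsum_mul_left]
  refine tsum_congr fun k => ?_
  rw [← (Equiv.subRight k).tsum_eq u]
  rfl

theorem cross_sum_le {d : ℕ} {q r : ℝ} (hq : 0 ≤ q) (v : (Fin d → ℤ) → Fin d → ℂ)
    (a : (Fin d → ℤ) → ℂ) :
    ∑ k ∈ zball d r, ∑' j, (if j ∈ zball d r then 0 else
        ENNReal.ofReal (cnorm (v (k - j)) * ‖a k‖ * ‖a j‖)) ≤ polyNorm q v * polyMass q a r := by
  set u : (Fin d → ℤ) → ℝ≥0∞ := fun k => ENNReal.ofReal ((1 + znorm k) ^ q * cnorm (v k)) with hu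
  set f : (Fin d → ℤ) → ℝ≥0∞ := fun k => decay q (znorm k - r) * (‖a k‖₊ : ℝ≥0∞) ^ 2 with hf
  have hf' : ∀ k, f k = ENNReal.ofReal ((1 + |znorm k - r|) ^ (-q) * ‖a k‖ ^ 2) := fun k => by
    rw [hf, ENNReal.ofReal_mul (by positivity), ENNReal.ofReal_pow (norm_nonneg _),
      ofReal_norm]
    rfl
  have hpt : ∀ k ∈ zball d r, ∀ j, (if j ∈ zball d r then 0 else
        ENNReal.ofReal (cnorm (v (k - j)) * ‖a k‖ * ‖a j‖)) ≤
        ENNReal.ofReal (1 / 2) * (u (k - j) * f k) + ENNReal.ofReal (1 / 2) * (u (k - j) * f j) := by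
    intro k hk j
    split_ifs with hj
    · exact zero_le
    rw [mem_zball] at hk hj
    rw [hf', hf', hu]
    have hz : 0 ≤ (1 + znorm (k - j)) ^ q * cnorm (v (k - j)) :=
      mul_nonneg (Real.rpow_nonneg (by linarith [znorm_nonneg (k - j)]) _) (cnorm_nonneg _)
    simp only
    rw [← ENNReal.ofReal_mul hz, ← ENNReal.ofReal_mul hz,
      ← ENNReal.ofReal_mul (by norm_num), ← ENNReal.ofReal_mul (by norm_num),
      ← ENNReal.ofReal_add (by positivity) (by positivity)]
    refine ENNReal.ofReal_le_ofReal ?_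
    refine cross_term_le (cnorm_nonneg _) (norm_nonneg _) (norm_nonneg _) hq ?_
    rw [abs_of_neg (by linarith), abs_of_nonneg (by linarith)]
    have := (abs_le.1 (abs_znorm_sub_le k j)).1
    linarith
  calc _ ≤ ∑ k ∈ zball d r, ∑' j, (ENNReal.ofReal (1 / 2) * (u (k - j) * f k) +
          ENNReal.ofReal (1 / 2) * (u (k - j) * f j)) :=
        Finset.sum_le_sum fun k hk => ENNReal.tsum_le_tsum (hpt k hk)
    _ ≤ ∑' k, ∑' j, (ENNReal.ofReal (1 / 2) * (u (k - j) * f k) +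
          ENNReal.ofReal (1 / 2) * (u (k - j) * f j)) := ENNReal.sum_le_tsum _
    _ = ENNReal.ofReal (1 / 2) * ((∑' k, u k) * ∑' k, f k) +
          ENNReal.ofReal (1 / 2) * ((∑' k, u k) * ∑' k, f k) := by
        simp_rw [ENNReal.tsum_add, ENNReal.tsum_mul_left]
        rw [tsum_sub_mul, tsum_sub_mul']
    _ = polyNorm q v * polyMass q a r := by
        rw [← add_mul, ← ENNReal.ofReal_add (by norm_num) (by norm_num)]
        norm_num
        rfl

theorem summable_cnorm_of_polyNorm_ne_top {d : ℕ} {q : ℝ} (hq : 0 ≤ q)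
    {v : (Fin d → ℤ) → Fin d → ℂ} (hv : polyNorm q v ≠ ⊤) : Summable fun k => cnorm (v k) := by
  have h := ENNReal.summable_toReal hv
  refine h.of_nonneg_of_le (fun _ => cnorm_nonneg _) fun k => ?_
  have h0 := cnorm_nonneg (v k)
  have h1 : 1 ≤ (1 + znorm k) ^ q :=
    Real.one_le_rpow (by linarith [znorm_nonneg k]) hq
  rw [ENNReal.toReal_ofReal (by positivity)]
  nlinarith

theorem interaction_im_eq_zero {d : ℕ} {v : (Fin d → ℤ) → Fin d → ℂ} (hdiv : DivFree v)
    (hreal : RealCoeff v) (a : (Fin d → ℤ) → ℂ) (B : Finset (Fin d → ℤ)) :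
    (∑ k ∈ B, starRingEnd ℂ (a k) * ∑ j ∈ B, zdot k (v (k - j)) * a j).im = 0 := by
  rw [← Complex.conj_eq_iff_im]
  simp only [map_sum, map_mul, Finset.mul_sum, Complex.conj_conj]
  rw [Finset.sum_comm]
  refine Finset.sum_congr rfl fun k _ => Finset.sum_congr rfl fun j _ => ?_
  have h : starRingEnd ℂ (zdot j (v (j - k))) = zdot k (v (k - j)) := by
    have h1 : zdot (k - j) (v (k - j)) = 0 := hdiv _
    have h2 : zdot (k - j) (v (k - j)) = zdot k (v (k - j)) - zdot j (v (k - j)) := by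
      simp [zdot, sub_mul, Finset.sum_sub_distrib]
    have h3 : starRingEnd ℂ (zdot j (v (j - k))) = zdot j (v (k - j)) := by
      simp only [zdot, map_sum, map_mul, map_intCast]
      refine Finset.sum_congr rfl fun i _ => ?_
      rw [← hreal (j - k) i, neg_sub]
    rw [h3]
    linear_combination h2 - h1
  rw [h]
  ring

theorem flux_le {d : ℕ} {ν q r : ℝ} (hq : 0 ≤ q) (hr : 0 ≤ r) {v : (Fin d → ℤ) → Fin d → ℂ}
    (hdiv : DivFree v) (hreal : RealCoeff v) (hv : polyNorm q v ≠ ⊤) {a : (Fin d → ℤ) → ℂ}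
    {A : ℝ} (ha : ∀ k, ‖a k‖ ≤ A) :
    ENNReal.ofReal |∑ k ∈ zball d r, 2 * (starRingEnd ℂ (a k) * fourierRHS ν v a k).re +
        ∑ k ∈ zball d r, 8 * π ^ 2 * ν * znorm k ^ 2 * ‖a k‖ ^ 2| ≤
      ENNReal.ofReal (4 * π * r) * (polyNorm q v * polyMass q a r) := by
  set B := zball d r with hB
  have hsum : ∀ k, Summable fun j => zdot k (v (k - j)) * a j := fun k => by
    have h1 : Summable fun j => znorm k * cnorm (v (k - j)) * A :=
      (((Equiv.subLeft k).summable_iff.2 (summable_cnorm_of_polyNorm_ne_top hq hv)).mul_left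
        _).mul_right _
    refine Summable.of_norm_bounded h1 fun j => ?_
    rw [norm_mul]
    exact mul_le_mul (norm_zdot_le _ _) (ha j) (norm_nonneg _)
      (mul_nonneg (znorm_nonneg _) (cnorm_nonneg _))
  set O : (Fin d → ℤ) → ℂ := fun k =>
    ∑' j, if j ∈ B then 0 else zdot k (v (k - j)) * a j with hO
  have hsplit : ∀ k, ∑' j, zdot k (v (k - j)) * a j =
      ∑ j ∈ B, zdot k (v (k - j)) * a j + O k := fun k => by
    have e1 : ∑ j ∈ B, zdot k (v (k - j)) * a j =
        ∑' j, if j ∈ B then zdot k (v (k - j)) * a j else 0 := by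
      rw [tsum_eq_sum (s := B) (fun j hj => if_neg hj)]
      exact Finset.sum_congr rfl fun j hj => (if_pos hj).symm
    have s1 : Summable fun j => if j ∈ B then zdot k (v (k - j)) * a j else 0 :=
      summable_of_ne_finset_zero (s := B) fun j hj => if_neg hj
    have s2 : Summable fun j => if j ∈ B then 0 else zdot k (v (k - j)) * a j := by
      refine ((hsum k).sub s1).congr fun j => ?_
      split_ifs <;> simp
    rw [e1, hO, ← s1.tsum_add s2]
    refine tsum_congr fun j => ?_
    split_ifs <;> simp
  set S : ℂ := ∑ k ∈ B, starRingEnd ℂ (a k) * O k with hS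
  have hid : ∑ k ∈ B, 2 * (starRingEnd ℂ (a k) * fourierRHS ν v a k).re +
        ∑ k ∈ B, 8 * π ^ 2 * ν * znorm k ^ 2 * ‖a k‖ ^ 2 = 4 * π * S.im := by
    have h0 := interaction_im_eq_zero hdiv hreal a B
    have h1 : ∀ k, 2 * (starRingEnd ℂ (a k) * fourierRHS ν v a k).re +
        8 * π ^ 2 * ν * znorm k ^ 2 * ‖a k‖ ^ 2 = 4 * π *
        ((starRingEnd ℂ (a k) * ∑ j ∈ B, zdot k (v (k - j)) * a j).im +
          (starRingEnd ℂ (a k) * O k).im) := fun k => by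
      rw [fourierRHS, hsplit, ← Complex.normSq_eq_norm_sq, Complex.normSq_apply]
      rw [show 8 * π ^ 2 * ν * znorm k ^ 2 = 2 * (4 * π ^ 2 * ν * znorm k ^ 2) by ring]
      generalize 4 * π ^ 2 * ν * znorm k ^ 2 = y
      generalize ∑ j ∈ B, zdot k (v (k - j)) * a j = x
      simp
      ring
    rw [← Finset.sum_add_distrib, Finset.sum_congr rfl fun k _ => h1 k, ← Finset.mul_sum,
      Finset.sum_add_distrib, ← Complex.im_sum, ← Complex.im_sum, h0, zero_add]
  rw [hid, abs_mul, abs_of_nonneg (by positivity : (0 : ℝ) ≤ 4 * π),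
    ENNReal.ofReal_mul (by positivity : (0 : ℝ) ≤ 4 * π),
    ENNReal.ofReal_mul (by positivity : (0 : ℝ) ≤ 4 * π), mul_assoc]
  refine mul_le_mul_right ?_ _
  calc ENNReal.ofReal |S.im| ≤ ENNReal.ofReal ‖S‖ :=
        ENNReal.ofReal_le_ofReal (Complex.abs_im_le_norm S)
    _ = ‖S‖ₑ := ofReal_norm _
    _ ≤ ∑ k ∈ B, ‖starRingEnd ℂ (a k) * O k‖ₑ := enorm_sum_le _ _
    _ ≤ ∑ k ∈ B, ENNReal.ofReal r * ∑' j, (if j ∈ B then 0 else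
        ENNReal.ofReal (cnorm (v (k - j)) * ‖a k‖ * ‖a j‖)) := by
        refine Finset.sum_le_sum fun k hk => ?_
        rw [enorm_mul]
        calc _ ≤ ‖starRingEnd ℂ (a k)‖ₑ *
              ∑' j, ‖if j ∈ B then 0 else zdot k (v (k - j)) * a j‖ₑ := by
              gcongr
              exact enorm_tsum_le_tsum_enorm
          _ ≤ _ := by
              rw [← ENNReal.tsum_mul_left, ← ENNReal.tsum_mul_left]
              refine ENNReal.tsum_le_tsum fun j => ?_
              split_ifs
              · simp
              rw [← enorm_mul, ← ofReal_norm, ← ENNReal.ofReal_mul hr]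
              refine ENNReal.ofReal_le_ofReal ?_
              rw [norm_mul, norm_mul, RCLike.norm_conj]
              have hk' : znorm k < r := mem_zball.1 hk
              have := cnorm_nonneg (v (k - j))
              calc ‖a k‖ * (‖zdot k (v (k - j))‖ * ‖a j‖)
                  ≤ ‖a k‖ * ((r * cnorm (v (k - j))) * ‖a j‖) := by
                    have := (norm_zdot_le k (v (k - j))).trans
                      (mul_le_mul_of_nonneg_right hk'.le this)
                    gcongr
                _ = _ := by ring
    _ ≤ _ := by
        rw [← Finset.mul_sum]
        gcongr
        exact cross_sum_le hq v a

theorem ofReal_sub_le_lintegral {f f' : ℝ → ℝ} {T : ℝ} (hT : 0 ≤ T)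
    (hf : ∀ t ∈ Ici (0 : ℝ), HasDerivWithinAt f (f' t) (Ici 0) t) {F G : ℝ → ℝ≥0∞}
    (hG : ∫⁻ t in Icc 0 T, G t ≠ ⊤)
    (hfG : ∀ᵐ t ∂volume.restrict (Icc 0 T), ENNReal.ofReal |f' t| ≤ G t)
    (hfF : ∀ᵐ t ∂volume.restrict (Icc 0 T), ENNReal.ofReal (f' t) ≤ F t) :
    ENNReal.ofReal (f T - f 0) ≤ ∫⁻ t in Icc 0 T, F t := by
  have hd : ∀ t, 0 < t → HasDerivAt f (f' t) t := fun t ht =>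
    (hf t ht.le).hasDerivAt (Ici_mem_nhds ht)
  have hne : ∀ᵐ t ∂volume.restrict (Icc 0 T), deriv f t = f' t := by
    have h0 : ∀ᵐ t ∂(volume : Measure ℝ), t ≠ 0 := by simp [ae_iff]
    filter_upwards [ae_restrict_of_ae h0, ae_restrict_mem measurableSet_Icc] with t ht ht'
    exact (hd t (lt_of_le_of_ne ht'.1 (Ne.symm ht))).deriv
  have hint : IntegrableOn (deriv f) (Icc 0 T) := by
    refine ⟨(measurable_deriv f).aestronglyMeasurable, ?_⟩
    refine lt_of_le_of_lt (lintegral_mono_ae ?_) (lt_top_iff_ne_top.2 hG)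
    filter_upwards [hne, hfG] with t h1 h2
    rwa [h1, ← ofReal_norm, Real.norm_eq_abs]
  have hftc : ∫ t in Icc 0 T, deriv f t = f T - f 0 := by
    rw [integral_Icc_eq_integral_Ioc, ← intervalIntegral.integral_of_le hT]
    refine intervalIntegral.integral_eq_sub_of_hasDerivAt_of_le hT
      (fun t ht => ((hf t ht.1).continuousWithinAt).mono Icc_subset_Ici_self)
      (fun t ht => (hd t ht.1).differentiableAt.hasDerivAt) ?_
    rw [intervalIntegrable_iff_integrableOn_Icc_of_le hT]
    exact hint
  rw [← hftc]
  calc ENNReal.ofReal (∫ t in Icc 0 T, deriv f t)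
      ≤ ENNReal.ofReal (∫ t in Icc 0 T, max (deriv f t) 0) :=
        ENNReal.ofReal_le_ofReal (integral_mono hint hint.pos_part fun t => le_max_left _ _)
    _ = ∫⁻ t in Icc 0 T, ENNReal.ofReal (max (deriv f t) 0) :=
        ofReal_integral_eq_lintegral_ofReal hint.pos_part
          (Filter.Eventually.of_forall fun t => le_max_right _ _)
    _ ≤ ∫⁻ t in Icc 0 T, F t := by
        refine lintegral_mono_ae ?_
        filter_upwards [hne, hfF] with t h1 h2
        rw [h1, ENNReal.ofReal_max, ENNReal.ofReal_zero, max_eq_left zero_le]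
        exact h2

/-- A deterministic path of the Fourier advection–diffusion system whose velocity has
locally integrable `polyNorm q`. -/
structure IsPath {d : ℕ} (ν q : ℝ) (v : ℝ → (Fin d → ℤ) → Fin d → ℂ)
    (a : ℝ → (Fin d → ℤ) → ℂ) : Prop where
  velocity : ∀ t : ℝ, 0 ≤ t → DivFree (v t) ∧ RealCoeff (v t)
  hasDeriv : ∀ k : Fin d → ℤ, ∀ t ∈ Set.Ici (0 : ℝ),
    HasDerivWithinAt (fun s => a s k) (fourierRHS ν (v t) (a t) k) (Set.Ici 0) t
  decay : ∀ N : ℕ, ∀ T > (0 : ℝ), ∃ M : ℝ, ∀ t ∈ Set.Icc (0 : ℝ) T,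
    ∑' k : Fin d → ℤ, ENNReal.ofReal ((1 + znorm k) ^ N) * (‖a t k‖₊ : ℝ≥0∞) ^ 2
      ≤ ENNReal.ofReal M
  measurable : Measurable fun t => polyNorm q (v t)
  integrable : ∀ T > (0 : ℝ), ∫⁻ t in Set.Icc (0 : ℝ) T, polyNorm q (v t) ≠ ⊤

theorem decay_le_one {q : ℝ} (hq : 0 ≤ q) (s : ℝ) : decay q s ≤ 1 := by
  rw [decay, ← ENNReal.ofReal_one]
  refine ENNReal.ofReal_le_ofReal (Real.rpow_le_one_of_one_le_of_nonpos ?_ (by linarith))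
  linarith [abs_nonneg s]

theorem polyMass_le_tsum {d : ℕ} {q : ℝ} (hq : 0 ≤ q) (a : (Fin d → ℤ) → ℂ) (r : ℝ) :
    polyMass q a r ≤ ∑' k, (‖a k‖₊ : ℝ≥0∞) ^ 2 :=
  ENNReal.tsum_le_tsum fun k => by
    simpa using mul_le_mul_left (decay_le_one hq (znorm k - r)) ((‖a k‖₊ : ℝ≥0∞) ^ 2)

theorem polyMass_le_sq {d : ℕ} {q r : ℝ} (hq : 2 ≤ q) (hr : 0 ≤ r) (a : (Fin d → ℤ) → ℂ) :
    polyMass q a r ≤ ENNReal.ofReal (((1 + r) ^ 2)⁻¹) *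
      ∑' k, ENNReal.ofReal ((1 + znorm k) ^ 2) * (‖a k‖₊ : ℝ≥0∞) ^ 2 := by
  rw [← ENNReal.tsum_mul_left]
  refine ENNReal.tsum_le_tsum fun k => ?_
  rw [← mul_assoc, ← ENNReal.ofReal_mul (by positivity)]
  refine mul_le_mul_left (ENNReal.ofReal_le_ofReal ?_) _
  have hz := znorm_nonneg k
  have hs := abs_nonneg (znorm k - r)
  set s := |znorm k - r| with hs'
  have h1 : r ≤ znorm k + s := by linarith [neg_abs_le (znorm k - r)]
  have h2 : (1 + s) ^ (-q) ≤ ((1 + s) ^ 2)⁻¹ := by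
    rw [Real.rpow_neg (by linarith)]
    gcongr
    calc (1 + s) ^ 2 = (1 + s) ^ (2 : ℝ) := (Real.rpow_two _).symm
      _ ≤ (1 + s) ^ q := Real.rpow_le_rpow_of_exponent_le (by linarith) hq
  refine h2.trans ?_
  rw [inv_mul_eq_div, inv_eq_one_div, div_le_div_iff₀ (by positivity) (by positivity), one_mul,
    ← mul_pow]
  gcongr
  nlinarith

theorem coe_nnnorm_sq {z : ℂ} : (‖z‖₊ : ℝ≥0∞) ^ 2 = ENNReal.ofReal (‖z‖ ^ 2) := by
  rw [ENNReal.ofReal_pow (norm_nonneg _), ofReal_norm]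
  rfl

theorem ofReal_sum_sq {d : ℕ} (a : (Fin d → ℤ) → ℂ) (B : Finset (Fin d → ℤ)) :
    ENNReal.ofReal (∑ k ∈ B, ‖a k‖ ^ 2) = ∑ k ∈ B, (‖a k‖₊ : ℝ≥0∞) ^ 2 := by
  rw [ENNReal.ofReal_sum_of_nonneg fun _ _ => sq_nonneg _]
  simp_rw [coe_nnnorm_sq]

namespace IsPath

variable {d : ℕ} {ν q : ℝ} {v : ℝ → (Fin d → ℤ) → Fin d → ℂ} {a : ℝ → (Fin d → ℤ) → ℂ}

theorem exists_tsum_le (h : IsPath ν q v a) {T : ℝ} (hT : 0 < T) :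
    ∃ M : ℝ, 0 ≤ M ∧ ∀ t ∈ Icc (0 : ℝ) T, ∑' k, (‖a t k‖₊ : ℝ≥0∞) ^ 2 ≤ ENNReal.ofReal M := by
  obtain ⟨M, hM⟩ := h.decay 0 T hT
  refine ⟨max M 0, le_max_right _ _, fun t ht => ?_⟩
  have := hM t ht
  simp only [pow_zero, ENNReal.ofReal_one, one_mul] at this
  exact this.trans (ENNReal.ofReal_le_ofReal (le_max_left _ _))

theorem hasDeriv_sum (h : IsPath ν q v a) (B : Finset (Fin d → ℤ)) {t : ℝ} (ht : t ∈ Ici (0 : ℝ)) :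
    HasDerivWithinAt (fun s => ∑ k ∈ B, ‖a s k‖ ^ 2)
      (∑ k ∈ B, 2 * (starRingEnd ℂ (a t k) * fourierRHS ν (v t) (a t) k).re) (Ici 0) t := by
  refine HasDerivWithinAt.fun_sum fun k _ => ?_
  have := (h.hasDeriv k t ht).norm_sq
  rw [Complex.inner, mul_comm (fourierRHS _ _ _ _)] at this
  exact this

theorem ae_flux_le (h : IsPath ν q v a) (hq : 0 ≤ q) {r T : ℝ} (hr : 0 ≤ r) (hT : 0 < T) :
    ∀ᵐ t ∂volume.restrict (Icc 0 T),
      ENNReal.ofReal |∑ k ∈ zball d r, 2 * (starRingEnd ℂ (a t k) * fourierRHS ν (v t) (a t) k).re +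
        ∑ k ∈ zball d r, 8 * π ^ 2 * ν * znorm k ^ 2 * ‖a t k‖ ^ 2| ≤
      ENNReal.ofReal (4 * π * r) * (polyNorm q (v t) * polyMass q (a t) r) := by
  obtain ⟨M, hM0, hM⟩ := h.exists_tsum_le hT
  filter_upwards [ae_lt_top h.measurable (h.integrable T hT),
    ae_restrict_mem measurableSet_Icc] with t ht ht'
  refine flux_le hq hr (h.velocity t ht'.1).1 (h.velocity t ht'.1).2 ht.ne (A := Real.sqrt M)
    fun k => ?_
  have h1 := (ENNReal.le_tsum k).trans (hM t ht')
  rw [coe_nnnorm_sq] at h1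
  exact Real.le_sqrt_of_sq_le ((ENNReal.ofReal_le_ofReal_iff hM0).1 h1)

theorem dissipation_le (hν : 0 ≤ ν) {r A t : ℝ} (hA : 0 ≤ A)
    (h : ∑' k, (‖a t k‖₊ : ℝ≥0∞) ^ 2 ≤ ENNReal.ofReal A) :
    ∑ k ∈ zball d r, 8 * π ^ 2 * ν * znorm k ^ 2 * ‖a t k‖ ^ 2 ≤ 8 * π ^ 2 * ν * r ^ 2 * A := by
  have h1 : ∑ k ∈ zball d r, ‖a t k‖ ^ 2 ≤ A := by
    rw [← ENNReal.ofReal_le_ofReal_iff hA, ofReal_sum_sq]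
    exact (ENNReal.sum_le_tsum _).trans h
  calc _ ≤ ∑ k ∈ zball d r, 8 * π ^ 2 * ν * r ^ 2 * ‖a t k‖ ^ 2 := by
        refine Finset.sum_le_sum fun k hk => ?_
        have := znorm_nonneg k
        have := (mem_zball.1 hk).le
        gcongr
    _ ≤ _ := by
        rw [← Finset.mul_sum]
        gcongr

theorem ae_abs_deriv_le (h : IsPath ν q v a) (hν : 0 ≤ ν) (hq : 0 ≤ q) {r T : ℝ} (hr : 0 ≤ r)
    (hT : 0 < T) :
    ∃ G : ℝ → ℝ≥0∞, ∫⁻ t in Icc 0 T, G t ≠ ⊤ ∧ ∀ᵐ t ∂volume.restrict (Icc 0 T),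
      ENNReal.ofReal |∑ k ∈ zball d r,
        2 * (starRingEnd ℂ (a t k) * fourierRHS ν (v t) (a t) k).re| ≤ G t := by
  obtain ⟨M, hM0, hM⟩ := h.exists_tsum_le hT
  refine ⟨fun t => ENNReal.ofReal (8 * π ^ 2 * ν * r ^ 2 * M) +
    ENNReal.ofReal (4 * π * r) * (polyNorm q (v t) * ENNReal.ofReal M), ?_, ?_⟩
  · rw [lintegral_add_left measurable_const, lintegral_const_mul' _ _ ENNReal.ofReal_ne_top,
      lintegral_mul_const' _ _ ENNReal.ofReal_ne_top]
    refine ENNReal.add_ne_top.2 ⟨?_, ENNReal.mul_ne_top ENNReal.ofReal_ne_top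
      (ENNReal.mul_ne_top (h.integrable T hT) ENNReal.ofReal_ne_top)⟩
    rw [setLIntegral_const]
    exact ENNReal.mul_ne_top ENNReal.ofReal_ne_top (by simp)
  · filter_upwards [h.ae_flux_le hq hr hT, ae_restrict_mem measurableSet_Icc] with t h1 ht
    have h2 := dissipation_le (r := r) hν hM0 (hM t ht)
    set x := ∑ k ∈ zball d r, 2 * (starRingEnd ℂ (a t k) * fourierRHS ν (v t) (a t) k).re
    set y := ∑ k ∈ zball d r, 8 * π ^ 2 * ν * znorm k ^ 2 * ‖a t k‖ ^ 2 with hy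
    have hy0 : 0 ≤ y := Finset.sum_nonneg fun k _ => by positivity
    calc ENNReal.ofReal |x| ≤ ENNReal.ofReal (y + |x + y|) := by
          refine ENNReal.ofReal_le_ofReal ?_
          rw [abs_le]
          constructor <;> linarith [neg_abs_le (x + y), le_abs_self (x + y)]
      _ = ENNReal.ofReal y + ENNReal.ofReal |x + y| :=
          ENNReal.ofReal_add hy0 (abs_nonneg _)
      _ ≤ _ := by
          refine add_le_add (ENNReal.ofReal_le_ofReal h2) (h1.trans ?_)
          gcongr
          exact (polyMass_le_tsum hq _ _).trans (hM t ht)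

theorem sum_le_add_flux (h : IsPath ν q v a) (hν : 0 ≤ ν) (hq : 0 ≤ q) {r T : ℝ} (hr : 0 ≤ r)
    (hT : 0 < T) :
    ∑ k ∈ zball d r, (‖a T k‖₊ : ℝ≥0∞) ^ 2 ≤ ∑ k ∈ zball d r, (‖a 0 k‖₊ : ℝ≥0∞) ^ 2 +
      ENNReal.ofReal (4 * π * r) * ∫⁻ t in Icc 0 T, polyNorm q (v t) * polyMass q (a t) r := by
  obtain ⟨G, hG, hG'⟩ := h.ae_abs_deriv_le hν hq hr hT
  have := ofReal_sub_le_lintegral hT.le (fun t ht => h.hasDeriv_sum (zball d r) ht) hG hG'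
    (F := fun t => ENNReal.ofReal (4 * π * r) * (polyNorm q (v t) * polyMass q (a t) r)) (by
      filter_upwards [h.ae_flux_le hq hr hT] with t h1
      refine (ENNReal.ofReal_le_ofReal ?_).trans h1
      refine le_trans ?_ (le_abs_self _)
      exact le_add_of_nonneg_right (Finset.sum_nonneg fun k _ => by positivity))
  rw [lintegral_const_mul' _ _ ENNReal.ofReal_ne_top,
    ENNReal.ofReal_sub _ (Finset.sum_nonneg fun k _ => sq_nonneg _), ofReal_sum_sq,
    ofReal_sum_sq, tsub_le_iff_left] at this
  exact this

theorem tsum_le_one (h : IsPath ν q v a) (hν : 0 ≤ ν) (hq : 2 ≤ q)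
    (h0 : ∑' k, (‖a 0 k‖₊ : ℝ≥0∞) ^ 2 = 1) {t : ℝ} (ht : 0 ≤ t) :
    ∑' k, (‖a t k‖₊ : ℝ≥0∞) ^ 2 ≤ 1 := by
  rcases ht.eq_or_lt with rfl | ht
  · exact h0.le
  obtain ⟨M, hM⟩ := h.decay 2 t ht
  set X : ℝ≥0∞ := (∫⁻ s in Icc 0 t, polyNorm q (v s)) * ENNReal.ofReal M with hX
  have hXtop : X ≠ ⊤ := ENNReal.mul_ne_top (h.integrable t ht) ENNReal.ofReal_ne_top
  have key : ∀ n : ℕ, ∑ k ∈ zball d n, (‖a t k‖₊ : ℝ≥0∞) ^ 2 ≤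
      1 + ENNReal.ofReal (4 * π * (1 / ((n : ℝ) + 1))) * X := fun n => by
    have hn : (0 : ℝ) ≤ n := n.cast_nonneg
    refine (h.sum_le_add_flux hν (by linarith) hn ht).trans
      (add_le_add ((ENNReal.sum_le_tsum _).trans h0.le) ?_)
    calc _ ≤ ENNReal.ofReal (4 * π * n) * ∫⁻ s in Icc 0 t, polyNorm q (v s) *
          (ENNReal.ofReal (((1 + (n : ℝ)) ^ 2)⁻¹) * ENNReal.ofReal M) := by
          refine mul_le_mul_right (lintegral_mono_ae ?_) _
          filter_upwards [ae_restrict_mem measurableSet_Icc] with s hs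
          refine mul_le_mul_right ((polyMass_le_sq hq hn _).trans ?_) _
          exact mul_le_mul_right (hM s hs) _
      _ = ENNReal.ofReal (4 * π * n) * ENNReal.ofReal (((1 + (n : ℝ)) ^ 2)⁻¹) * X := by
          rw [lintegral_mul_const' _ _
            (ENNReal.mul_ne_top ENNReal.ofReal_ne_top ENNReal.ofReal_ne_top), hX]
          ring
      _ ≤ _ := by
          rw [← ENNReal.ofReal_mul (by positivity)]
          refine mul_le_mul_left (ENNReal.ofReal_le_ofReal ?_) _
          rw [mul_assoc]
          gcongr
          rw [← div_eq_mul_inv, div_le_div_iff₀ (by positivity) (by positivity)]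
          nlinarith
  have hlim : Filter.Tendsto
      (fun n : ℕ => 1 + ENNReal.ofReal (4 * π * (1 / ((n : ℝ) + 1))) * X) Filter.atTop
      (nhds (1 + ENNReal.ofReal (4 * π * 0) * X)) := by
    refine tendsto_const_nhds.add (ENNReal.Tendsto.mul_const ?_ (Or.inr hXtop))
    exact ENNReal.tendsto_ofReal (tendsto_one_div_add_atTop_nhds_zero_nat.const_mul _)
  rw [mul_zero, ENNReal.ofReal_zero, zero_mul, add_zero] at hlim
  rw [ENNReal.tsum_eq_iSup_sum]
  refine iSup_le fun s => ge_of_tendsto hlim ?_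
  obtain ⟨n₀, hn₀⟩ := exists_nat_gt (∑ k ∈ s, znorm k)
  filter_upwards [Filter.eventually_ge_atTop n₀] with n hn
  refine le_trans (Finset.sum_le_sum_of_subset fun k hk => ?_) (key n)
  rw [mem_zball]
  calc znorm k ≤ ∑ k ∈ s, znorm k :=
        Finset.single_le_sum (fun k _ => znorm_nonneg k) hk
    _ < n₀ := hn₀
    _ ≤ n := by exact_mod_cast hn

theorem sum_initial_le (h : IsPath ν q v a) (hν : 0 ≤ ν) (hq : 2 ≤ q)
    (h0 : ∑' k, (‖a 0 k‖₊ : ℝ≥0∞) ^ 2 = 1) {r T : ℝ} (hr : 0 ≤ r) (hT : 0 < T) :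
    ∑ k ∈ zball d r, (‖a 0 k‖₊ : ℝ≥0∞) ^ 2 ≤ ∑ k ∈ zball d r, (‖a T k‖₊ : ℝ≥0∞) ^ 2 +
      (ENNReal.ofReal (8 * π ^ 2 * ν * r ^ 2 * T) +
      ENNReal.ofReal (4 * π * r) * ∫⁻ t in Icc 0 T, polyNorm q (v t) * polyMass q (a t) r) := by
  have hq0 : 0 ≤ q := by linarith
  obtain ⟨G, hG, hG'⟩ := h.ae_abs_deriv_le hν hq0 hr hT
  have := ofReal_sub_le_lintegral hT.le (fun t ht => (h.hasDeriv_sum (zball d r) ht).neg) hG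
    (by simpa only [abs_neg] using hG')
    (F := fun t => ENNReal.ofReal (8 * π ^ 2 * ν * r ^ 2) +
      ENNReal.ofReal (4 * π * r) * (polyNorm q (v t) * polyMass q (a t) r)) (by
      filter_upwards [h.ae_flux_le hq0 hr hT, ae_restrict_mem measurableSet_Icc] with t h1 ht
      have h2 := dissipation_le (r := r) hν zero_le_one
        ((h.tsum_le_one hν hq h0 ht.1).trans_eq ENNReal.ofReal_one.symm)
      rw [mul_one] at h2
      refine le_trans ?_ (add_le_add_right h1 _)
      rw [← ENNReal.ofReal_add (by positivity) (abs_nonneg _)]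
      refine ENNReal.ofReal_le_ofReal ?_
      set x := ∑ k ∈ zball d r, 2 * (starRingEnd ℂ (a t k) * fourierRHS ν (v t) (a t) k).re
      set y := ∑ k ∈ zball d r, 8 * π ^ 2 * ν * znorm k ^ 2 * ‖a t k‖ ^ 2
      linarith [neg_abs_le (x + y)])
  simp only [Pi.neg_apply] at this
  rw [lintegral_add_left measurable_const, lintegral_const_mul' _ _ ENNReal.ofReal_ne_top,
    neg_sub_neg, ENNReal.ofReal_sub _ (Finset.sum_nonneg fun k _ => sq_nonneg _), ofReal_sum_sq,
    ofReal_sum_sq, tsub_le_iff_left, setLIntegral_const, Real.volume_Icc, sub_zero,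
    ← ENNReal.ofReal_mul (by positivity)] at this
  exact this

theorem apply_zero_eq (h : IsPath ν q v a) (h0 : a 0 0 = 0) {t : ℝ} (ht : 0 ≤ t) :
    a t 0 = 0 := by
  have h1 : ∀ s ∈ Ici (0 : ℝ), HasDerivWithinAt (fun s => a s 0) 0 (Ici 0) s := fun s hs => by
    have := h.hasDeriv 0 s hs
    simpa [fourierRHS, zdot, znorm] using this
  have := (convex_Ici (0 : ℝ)).norm_image_sub_le_of_norm_hasDerivWithin_le (C := 0) h1
    (fun s _ => by simp) self_mem_Ici ht
  simpa [h0] using this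

end IsPath

theorem sum_zball_le {d : ℕ} {a : (Fin d → ℤ) → ℂ} (h0 : a 0 = 0) (r : ℝ) :
    ∑ k ∈ zball d r, (‖a k‖₊ : ℝ≥0∞) ^ 2 ≤ ENNReal.ofReal ((2 * π * r) ^ 2) *
      ∑' k : Fin d → ℤ, if k = 0 then 0 else
        (ENNReal.ofReal ((2 * π * znorm k) ^ 2))⁻¹ * (‖a k‖₊ : ℝ≥0∞) ^ 2 := by
  rw [← ENNReal.tsum_mul_left]
  refine le_trans (Finset.sum_le_sum fun k hk => ?_) (ENNReal.sum_le_tsum (zball d r))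
  split_ifs with hk0
  · simp [hk0, h0]
  have hz := one_le_znorm hk0
  have hr := mem_zball.1 hk
  have hpos : 0 < (2 * π * znorm k) ^ 2 := by positivity
  rw [← mul_assoc]
  refine le_mul_of_one_le_left zero_le ?_
  rw [← ENNReal.div_eq_inv_mul.trans (mul_comm _ _),
    ENNReal.le_div_iff_mul_le (Or.inl (ENNReal.ofReal_pos.2 hpos).ne') (Or.inl ENNReal.ofReal_ne_top), one_mul]
  exact ENNReal.ofReal_le_ofReal (by gcongr)

theorem three_quarters_le_sum_zball {d : ℕ} {g : (Fin d → ℤ) → ℂ}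
    (hg : ∑' k : Fin d → ℤ, (‖g k‖₊ : ℝ≥0∞) ^ 2 = 1)
    (hne : ∃ s : ℝ, 1 ≤ s ∧ massOn g (Set.Ici s) ≤ ENNReal.ofReal (1 / 4)) {r : ℝ}
    (hr : sInf {s : ℝ | 1 ≤ s ∧ massOn g (Set.Ici s) ≤ ENNReal.ofReal (1 / 4)} < r) :
    ENNReal.ofReal (3 / 4) ≤ ∑ k ∈ zball d r, (‖g k‖₊ : ℝ≥0∞) ^ 2 := by
  obtain ⟨s, ⟨_, hs⟩, hsr⟩ := exists_lt_of_csInf_lt hne hr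
  have h1 : (1 : ℝ≥0∞) ≤ ∑ k ∈ zball d r, (‖g k‖₊ : ℝ≥0∞) ^ 2 + ENNReal.ofReal (1 / 4) := by
    rw [← hg]
    calc ∑' k : Fin d → ℤ, (‖g k‖₊ : ℝ≥0∞) ^ 2
        ≤ ∑' k : Fin d → ℤ, ((if k ∈ zball d r then (‖g k‖₊ : ℝ≥0∞) ^ 2 else 0) +
          if znorm k ∈ Ici s then (‖g k‖₊ : ℝ≥0∞) ^ 2 else 0) := by
          refine ENNReal.tsum_le_tsum fun k => ?_
          by_cases hk : k ∈ zball d r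
          · simp [hk]
          · have : znorm k ∈ Ici s := by
              rw [mem_zball, not_lt] at hk
              exact hsr.le.trans hk
            simp [hk, this]
      _ ≤ _ := by
          rw [ENNReal.tsum_add]
          refine add_le_add (le_of_eq ?_) hs
          rw [tsum_eq_sum (s := zball d r) (fun j hj => if_neg hj)]
          exact Finset.sum_congr rfl fun j hj => if_pos hj
  have h2 : (1 : ℝ≥0∞) = ENNReal.ofReal (3 / 4) + ENNReal.ofReal (1 / 4) := by
    rw [← ENNReal.ofReal_add (by norm_num) (by norm_num)]
    norm_num
  rw [h2] at h1
  exact (ENNReal.add_le_add_iff_right ENNReal.ofReal_ne_top).1 h1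

theorem measurable_decay (q : ℝ) : Measurable (decay q) := by
  unfold decay
  fun_prop

/-- The kernel `decay q` restricted to `c ≤ |s|`. -/
def decayTail (q c s : ℝ) : ℝ≥0∞ := if c ≤ |s| then decay q s else 0

theorem measurable_decayTail (q c : ℝ) : Measurable (decayTail q c) :=
  (measurable_decay q).ite (measurableSet_le measurable_const (by fun_prop)) measurable_const

theorem lintegral_decayTail_le {q c : ℝ} (hq : 2 ≤ q) (hc : 0 ≤ c) :
    ∫⁻ s, decayTail q c s ≤ ENNReal.ofReal (2 * (1 + c) ^ (1 - q)) := by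
  set H : ℝ → ℝ≥0∞ := (Ici (1 + c)).indicator fun u => ENNReal.ofReal (u ^ (-q)) with hH
  have hHm : Measurable H := Measurable.indicator (by fun_prop) measurableSet_Ici
  have hHint : ∫⁻ u, H u ≤ ENNReal.ofReal ((1 + c) ^ (1 - q)) := by
    rw [hH, lintegral_indicator measurableSet_Ici, setLIntegral_congr Ioi_ae_eq_Ici.symm,
      ← ofReal_integral_eq_lintegral_ofReal
        (integrableOn_Ioi_rpow_of_lt (by linarith) (by linarith)),
      integral_Ioi_rpow_of_lt (by linarith) (by linarith)]
    · refine ENNReal.ofReal_le_ofReal ?_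
      rw [show -q + 1 = 1 - q by ring, ← neg_div_neg_eq, neg_neg]
      exact div_le_self (Real.rpow_nonneg (by linarith) _) (by linarith)
    · filter_upwards [ae_restrict_mem measurableSet_Ioi] with u hu
      exact Real.rpow_nonneg (by linarith [mem_Ioi.1 hu]) _
  calc ∫⁻ s, decayTail q c s ≤ ∫⁻ s, (H (1 + s) + H (1 - s)) := by
        refine lintegral_mono fun s => ?_
        unfold decayTail
        split_ifs with hs
        · unfold decay
          rcases abs_choice s with h | h <;> rw [h] at hs ⊢
          · refine le_add_of_le_left ?_
            rw [hH, indicator_of_mem (by simpa using hs)]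
          · refine le_add_of_le_right ?_
            rw [hH, indicator_of_mem (by rw [mem_Ici]; linarith), sub_eq_add_neg]
        · exact zero_le
    _ = (∫⁻ u, H u) + ∫⁻ u, H u := by
        rw [lintegral_add_left (by fun_prop), lintegral_add_left_eq_self H,
          lintegral_sub_left_eq_self H]
    _ ≤ _ := by
        rw [two_mul, ENNReal.ofReal_add (by positivity) (by positivity)]
        exact add_le_add hHint hHint

theorem decayTail_zero (q : ℝ) : decayTail q 0 = decay q := by
  ext s
  simp [decayTail, abs_nonneg]

theorem lintegral_decay_le {q : ℝ} (hq : 2 ≤ q) : ∫⁻ s, decay q s ≤ 2 := by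
  have := lintegral_decayTail_le hq le_rfl
  simpa [decayTail_zero] using this

theorem lintegral_tsum_kernel_le {ι : Type*} [Countable ι] {κ : ℝ → ℝ≥0∞} (hκ : Measurable κ)
    {A : ℝ≥0∞} (hA : ∫⁻ s, κ s ≤ A) (n : ι → ℝ) (c : ι → ℝ≥0∞) :
    ∫⁻ s, ∑' k, κ (n k - s) * c k ≤ A * ∑' k, c k := by
  rw [lintegral_tsum fun k => by fun_prop, ← ENNReal.tsum_mul_left]
  refine ENNReal.tsum_le_tsum fun k => ?_
  rw [lintegral_mul_const _ (by fun_prop), lintegral_sub_left_eq_self κ]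
  gcongr

theorem le_add_rpow_mul {m p : ℝ} (hm : 0 < m) (hp : 1 ≤ p) (W : ℝ≥0∞) :
    W ≤ ENNReal.ofReal m + ENNReal.ofReal (m ^ (1 - p)) * W ^ p := by
  rcases le_total W (ENNReal.ofReal m) with h | h
  · exact le_add_of_le_left h
  refine le_add_of_le_right ?_
  by_cases hW : W = ⊤
  · rw [hW, ENNReal.top_rpow_of_pos (by linarith), ENNReal.mul_top]
    simpa using Real.rpow_pos_of_pos hm _
  lift W to NNReal using hW
  have hmW : m ≤ W := by
    rw [← ENNReal.ofReal_coe_nnreal] at h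
    exact (ENNReal.ofReal_le_ofReal_iff W.2).1 h
  have hW0 : (0 : ℝ) < W := hm.trans_le hmW
  rw [← ENNReal.ofReal_coe_nnreal, ENNReal.ofReal_rpow_of_pos hW0,
    ← ENNReal.ofReal_mul (by positivity)]
  refine ENNReal.ofReal_le_ofReal ?_
  calc (W : ℝ) = (W : ℝ) ^ (1 - p) * (W : ℝ) ^ p := by
        rw [← Real.rpow_add hW0]; simp
    _ ≤ _ := by
        refine mul_le_mul_of_nonneg_right ?_ (by positivity)
        exact Real.rpow_le_rpow_of_nonpos hm hmW (by linarith)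

theorem lintegral_lintegral_mul_add_le {X : Type*} [MeasurableSpace X] {P : Measure X} [SFinite P]
    {F D : ℝ → X → ℝ≥0∞} (hF : Measurable (Function.uncurry F))
    (hD : Measurable (Function.uncurry D)) {V : X → ℝ≥0∞} (hV : Measurable V) (M N : ℝ≥0∞)
    {A B : ℝ≥0∞} (hFA : ∀ᵐ x ∂P, ∫⁻ r, F r x ≤ A) (hDB : ∀ᵐ x ∂P, ∫⁻ r, D r x ≤ B) :
    ∫⁻ r, ∫⁻ x, (M * F r x + N * V x * D r x) ∂P ≤ M * A * P univ + N * B * ∫⁻ x, V x ∂P := by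
  have hG : Measurable (Function.uncurry fun r x => M * F r x + N * V x * D r x) :=
    (hF.const_mul M).add (((hV.comp measurable_snd).const_mul N).mul hD)
  rw [lintegral_lintegral_swap hG.aemeasurable]
  have hpt : ∀ᵐ x ∂P, ∫⁻ r, (M * F r x + N * V x * D r x) ≤ M * A + N * B * V x := by
    filter_upwards [hFA, hDB] with x h1 h2
    have m1 : Measurable fun r => F r x := hF.comp (measurable_id.prodMk measurable_const)
    have m2 : Measurable fun r => D r x := hD.comp (measurable_id.prodMk measurable_const)
    rw [lintegral_add_left (m1.const_mul M), lintegral_const_mul _ m1, lintegral_const_mul _ m2,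
      mul_right_comm N B]
    gcongr
  refine (lintegral_mono_ae hpt).trans_eq ?_
  rw [lintegral_add_left measurable_const, lintegral_const, lintegral_const_mul _ hV]

/-- If every circle of radius `r ∈ (N₀, 2R]` carries a definite flux controlled by `W` and the
masses `b k` at heights `n k`, then undercharged annuli have small logarithmic measure. -/
theorem lintegral_undercharged_le {X ι : Type*} [MeasurableSpace X] {P : Measure X} [SFinite P]
    [Countable ι] {n : ι → ℝ} {b : ι → X → ℝ≥0∞} (hb : ∀ k, Measurable (b k))
    (hb1 : ∀ᵐ x ∂P, ∑' k, b k x ≤ 1) {W : X → ℝ≥0∞} (hW : Measurable W)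
    {q p N₀ R h α : ℝ} (hq : 2 ≤ q) (hp : 1 ≤ p) (hh : 1 ≤ h) (hα : 0 < α)
    (hflux : ∀ r, N₀ < r → r ≤ 2 * R → ENNReal.ofReal (1 / 2) ≤
      ENNReal.ofReal (4 * π * r) * ∫⁻ x, W x * ∑' k, decay q (n k - r) * b k x ∂P) :
    ∫⁻ r in {r : ℝ | h ≤ r ∧ r ≤ R ∧
        ∫⁻ x, ∑' k, (if n k ∈ Icc r (r + h) then b k x else 0) ∂P ≤
          ENNReal.ofReal (α * h / r)} ∩ Icc N₀ R, ENNReal.ofReal r⁻¹ ≤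
      ENNReal.ofReal (32 * π) * (ENNReal.ofReal (1 / (192 * π * α)) *
        ENNReal.ofReal (2 * (1 + h / 3) ^ (1 - q)) * P univ +
        ENNReal.ofReal ((192 * π * α) ^ (p - 1)) * 2 * ∫⁻ x, W x ^ p ∂P) := by
  set m : ℝ := 1 / (192 * π * α) with hm
  have hm0 : 0 < m := by positivity
  have hN : m ^ (1 - p) = (192 * π * α) ^ (p - 1) := by
    rw [hm, one_div, Real.inv_rpow (by positivity), ← Real.rpow_neg (by positivity), neg_sub]
  set M := ENNReal.ofReal m with hM
  rw [← hN]
  set N := ENNReal.ofReal (m ^ (1 - p))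
  set D : ℝ → X → ℝ≥0∞ := fun r x => ∑' k, decay q (n k - r) * b k x with hD
  set F : ℝ → X → ℝ≥0∞ := fun r x => ∑' k, decayTail q (h / 3) (n k - r) * b k x with hF
  set c : ℝ → ι → X → ℝ≥0∞ := fun r k x => if n k ∈ Icc r (r + h) then b k x else 0 with hc
  have hcm : ∀ r k, Measurable (c r k) := fun r k => by
    simp only [hc]; split_ifs
    · exact hb k
    · exact measurable_const
  have hκ1 := measurable_decay q
  have hκ2 := measurable_decayTail q (h / 3)
  have hDm : Measurable (Function.uncurry D) := by
    simp only [hD, Function.uncurry_def]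
    exact Measurable.tsum fun k =>
      (hκ1.comp (by fun_prop)).mul ((hb k).comp measurable_snd)
  have hFm : Measurable (Function.uncurry F) := by
    simp only [hF, Function.uncurry_def]
    exact Measurable.tsum fun k =>
      (hκ2.comp (by fun_prop)).mul ((hb k).comp measurable_snd)
  have hGm : Measurable (Function.uncurry fun r x => M * F r x + N * W x ^ p * D r x) :=
    (hFm.const_mul M).add ((((hW.comp measurable_snd).pow_const p).const_mul N).mul hDm)
  set Φ : ℝ → ℝ≥0∞ := fun r => ∫⁻ x, (M * F r x + N * W x ^ p * D r x) ∂P with hΦ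
  have hΦm : Measurable Φ := hGm.lintegral_prod_right'
  have hΦint : ∫⁻ r, Φ r ≤ M * ENNReal.ofReal (2 * (1 + h / 3) ^ (1 - q)) * P univ +
        N * 2 * ∫⁻ x, W x ^ p ∂P := by
    refine lintegral_lintegral_mul_add_le hFm hDm (hW.pow_const p) M N ?_ ?_
    · filter_upwards [hb1] with x hx
      exact (lintegral_tsum_kernel_le hκ2 (lintegral_decayTail_le hq (by positivity)) n
        fun k => b k x).trans (mul_le_of_le_one_right zero_le hx)
    · filter_upwards [hb1] with x hx
      exact (lintegral_tsum_kernel_le hκ1 (lintegral_decay_le hq) n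
        fun k => b k x).trans (mul_le_of_le_one_right zero_le hx)
  clear_value Φ
  set G : ℝ → ℝ≥0∞ := fun r =>
    ENNReal.ofReal (96 * π / h) * ∫⁻ s in Icc (h / 3) (2 * h / 3), Φ (r + s) with hG
  have hΦ2 : Measurable (Function.uncurry fun r s => Φ (r + s)) :=
    hΦm.comp (measurable_fst.add measurable_snd)
  have hΦ3 : Measurable fun r => ∫⁻ s in Icc (h / 3) (2 * h / 3), Φ (r + s) :=
    hΦ2.lintegral_prod_right'
  have hGmeas : Measurable G := hΦ3.const_mul _
  have hGint : ∫⁻ r, G r = ENNReal.ofReal (32 * π) * ∫⁻ r, Φ r := by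
    rw [hG, lintegral_const_mul _ hΦ3,
      lintegral_lintegral_swap hΦ2.aemeasurable]
    simp_rw [lintegral_add_right_eq_self Φ]
    rw [setLIntegral_const, Real.volume_Icc, mul_comm (lintegral _ _), ← mul_assoc,
      ← ENNReal.ofReal_mul (by positivity)]
    congr 2
    field_simp
    ring
  have hbad : {r : ℝ | h ≤ r ∧ r ≤ R ∧ ∫⁻ x, ∑' k, c r k x ∂P ≤ ENNReal.ofReal (α * h / r)} ∩
      Icc N₀ R ⊆ {r | ENNReal.ofReal r⁻¹ ≤ G r} := by
    rintro r ⟨⟨hr, hrR, hmass⟩, hrN, -⟩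
    have hr0 : 0 < r := by linarith
    set S := Icc (h / 3) (2 * h / 3) with hS
    set E : ℝ → X → ℝ≥0∞ := fun s x => ∑' k, decay q (n k - (r + s)) * c r k x with hE
    have hEm : Measurable (Function.uncurry E) := by
      simp only [hE, Function.uncurry_def]
      exact Measurable.tsum fun k =>
        (hκ1.comp (by fun_prop)).mul ((hcm r k).comp measurable_snd)
    have hpt : ∀ s ∈ S, ∀ x, W x * D (r + s) x ≤
        M * E s x + (M * F (r + s) x + N * W x ^ p * D (r + s) x) := fun s hs x => by
      have h1 : D (r + s) x ≤ E s x + F (r + s) x := by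
        simp only [hD, hE, hF, hc]
        rw [← ENNReal.tsum_add]
        refine ENNReal.tsum_le_tsum fun k => ?_
        by_cases hk : n k ∈ Icc r (r + h)
        · rw [if_pos hk]; exact le_self_add
        · have : h / 3 ≤ |n k - (r + s)| := by
            rw [mem_Icc, not_and_or, not_le, not_le] at hk
            have := hs.1
            have := hs.2
            rcases hk with hk | hk
            · exact le_trans (by linarith) (neg_le_abs _)
            · exact le_trans (by linarith) (le_abs_self _)
          simp [hk, decayTail, this]
      calc W x * D (r + s) x ≤ (M + N * W x ^ p) * D (r + s) x :=
            mul_le_mul_left (le_add_rpow_mul hm0 hp _) _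
        _ = M * D (r + s) x + N * W x ^ p * D (r + s) x := add_mul _ _ _
        _ ≤ M * (E s x + F (r + s) x) + N * W x ^ p * D (r + s) x := by gcongr
        _ = _ := by rw [mul_add, add_assoc]
    have hEint : ∫⁻ s in S, ∫⁻ x, E s x ∂P ≤ ENNReal.ofReal (2 * (α * h / r)) := by
      calc ∫⁻ s in S, ∫⁻ x, E s x ∂P ≤ ∫⁻ s, ∫⁻ x, E s x ∂P := setLIntegral_le_lintegral _ _
        _ = ∫⁻ x, (∫⁻ s, E s x) ∂P := lintegral_lintegral_swap hEm.aemeasurable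
        _ ≤ ∫⁻ x, 2 * ∑' k, c r k x ∂P := by
            refine lintegral_mono fun x => ?_
            simp only [hE]
            rw [lintegral_add_left_eq_self (fun s => ∑' k, decay q (n k - s) * c r k x) r]
            exact lintegral_tsum_kernel_le hκ1 (lintegral_decay_le hq) n fun k => c r k x
        _ = 2 * ∫⁻ x, ∑' k, c r k x ∂P :=
            lintegral_const_mul _ (Measurable.tsum fun k => hcm r k)
        _ ≤ _ := by
            rw [ENNReal.ofReal_mul (by norm_num), ENNReal.ofReal_ofNat]
            gcongr
    clear_value E
    have hs1 : ∀ s ∈ S, ENNReal.ofReal (1 / 2) ≤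
        ENNReal.ofReal (8 * π * r) * (M * ∫⁻ x, E s x ∂P + Φ (r + s)) := fun s hs => by
      have hs1 := hs.1
      have hs2 := hs.2
      refine (hflux (r + s) (by linarith) (by linarith)).trans ?_
      refine mul_le_mul' (ENNReal.ofReal_le_ofReal ?_) ?_
      · rw [show 8 * π * r = 4 * π * (2 * r) by ring]
        gcongr
        linarith
      · have m1 : Measurable (E s) := hEm.comp (measurable_const.prodMk measurable_id)
        calc _ ≤ ∫⁻ x, (M * E s x + (M * F (r + s) x + N * W x ^ p * D (r + s) x)) ∂P :=
              lintegral_mono fun x => hpt s hs x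
          _ = _ := by
              rw [lintegral_add_left (m1.const_mul M), lintegral_const_mul _ m1, hΦ]
    have hΦs : Measurable fun s => Φ (r + s) := hΦm.comp (measurable_const.add measurable_id)
    have hmain : ENNReal.ofReal (h / 6) ≤ ENNReal.ofReal (h / 12) +
        ENNReal.ofReal (8 * π * r) * ∫⁻ s in S, Φ (r + s) := by
      calc ENNReal.ofReal (h / 6) = ∫⁻ s in S, ENNReal.ofReal (1 / 2) := by
            rw [setLIntegral_const, Real.volume_Icc, ← ENNReal.ofReal_mul (by norm_num)]
            congr 1; ring
        _ ≤ ∫⁻ s in S, ENNReal.ofReal (8 * π * r) * (M * ∫⁻ x, E s x ∂P + Φ (r + s)) :=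
            setLIntegral_mono' measurableSet_Icc hs1
        _ = ENNReal.ofReal (8 * π * r) * (M * (∫⁻ s in S, ∫⁻ x, E s x ∂P) +
              ∫⁻ s in S, Φ (r + s)) := by
            rw [lintegral_const_mul' _ _ ENNReal.ofReal_ne_top,
              lintegral_add_right _ hΦs,
              lintegral_const_mul' _ _ ENNReal.ofReal_ne_top]
        _ ≤ ENNReal.ofReal (8 * π * r) * (M * ENNReal.ofReal (2 * (α * h / r)) +
              ∫⁻ s in S, Φ (r + s)) := by gcongr
        _ = _ := by
            rw [mul_add, hM, ← ENNReal.ofReal_mul hm0.le, ← ENNReal.ofReal_mul (by positivity)]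
            congr 2
            rw [hm]
            field_simp
            norm_num
    have hmain2 : ENNReal.ofReal (h / 12) ≤
        ENNReal.ofReal (8 * π * r) * ∫⁻ s in S, Φ (r + s) := by
      rw [show h / 6 = h / 12 + h / 12 by ring,
        ENNReal.ofReal_add (by positivity) (by positivity)] at hmain
      exact (ENNReal.add_le_add_iff_left ENNReal.ofReal_ne_top).1 hmain
    calc ENNReal.ofReal r⁻¹ = ENNReal.ofReal (12 / (h * r)) * ENNReal.ofReal (h / 12) := by
          rw [← ENNReal.ofReal_mul (by positivity)]
          congr 1
          field_simp
      _ ≤ ENNReal.ofReal (12 / (h * r)) *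
            (ENNReal.ofReal (8 * π * r) * ∫⁻ s in S, Φ (r + s)) := by gcongr
      _ = G r := by
          rw [hG, ← mul_assoc, ← ENNReal.ofReal_mul (by positivity)]
          congr 2
          field_simp
          norm_num
  calc _ ≤ ∫⁻ r in {r | ENNReal.ofReal r⁻¹ ≤ G r}, ENNReal.ofReal r⁻¹ := lintegral_mono_set hbad
    _ ≤ ∫⁻ r in {r | ENNReal.ofReal r⁻¹ ≤ G r}, G r :=
        setLIntegral_mono' (measurableSet_le (by fun_prop) hGmeas) fun r hr => hr
    _ ≤ ∫⁻ r, G r := setLIntegral_le_lintegral _ _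
    _ ≤ _ := by
        rw [hGint]
        gcongr


theorem mixing_scale_le {K γ R r : ℝ} (hK : 1 ≤ K) (hγ : 0 < γ) (hR : 2 ≤ R) (hr : 0 ≤ r)
    (hrR : r ≤ 2 * R) :
    (2 * π * r) ^ 2 * (K * Real.exp (-γ *
      ((Real.log (128 * π ^ 2 * K) / Real.log 2 + 2) / γ * Real.log R))) ≤ 1 / 8 := by
  have hR0 : 0 < R := by linarith
  have h2 : 0 < Real.log 2 := Real.log_pos one_lt_two
  have hlog : Real.log 2 ≤ Real.log R := Real.log_le_log two_pos hR
  have hA0 : (1 : ℝ) ≤ 128 * π ^ 2 * K := by nlinarith [Real.pi_gt_three]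
  set A := Real.log (128 * π ^ 2 * K) with hA
  have hA1 : 0 ≤ A := Real.log_nonneg hA0
  have h3 : A ≤ A / Real.log 2 * Real.log R := by
    rw [div_mul_eq_mul_div, le_div_iff₀ h2]
    gcongr
  have h4 : 128 * π ^ 2 * K * R ^ 2 * Real.exp (-γ * ((A / Real.log 2 + 2) / γ * Real.log R))
      ≤ 1 := by
    have h5 : 128 * π ^ 2 * K * R ^ 2 = Real.exp (A + 2 * Real.log R) := by
      rw [Real.exp_add, hA, Real.exp_log (by positivity), two_mul, Real.exp_add,
        Real.exp_log hR0]
      ring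
    rw [h5, ← Real.exp_add, Real.exp_le_one_iff]
    have : -γ * ((A / Real.log 2 + 2) / γ * Real.log R)
        = -(A / Real.log 2 * Real.log R) - 2 * Real.log R := by
      field_simp
      ring
    linarith
  calc _ ≤ (2 * π * (2 * R)) ^ 2 *
        (K * Real.exp (-γ * ((A / Real.log 2 + 2) / γ * Real.log R))) := by gcongr
    _ = 128 * π ^ 2 * K * R ^ 2 *
        Real.exp (-γ * ((A / Real.log 2 + 2) / γ * Real.log R)) / 8 := by ring
    _ ≤ 1 / 8 := by gcongr

theorem diffusion_scale_le {ν R C B r : ℝ} (hν : 0 < ν) (hν1 : ν ≤ Real.exp (-1)) (hR : 2 ≤ R)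
    (hB : 0 ≤ B) (hC : 1000 * (1 + 2 * B) ≤ C)
    (hRν : R ≤ ν ^ (-(1 / 2) : ℝ) / (C * Real.sqrt (Real.log ν⁻¹))) (hr : 0 ≤ r)
    (hrR : r ≤ 2 * R) :
    8 * π ^ 2 * ν * r ^ 2 * (B * Real.log R) ≤ 1 / 8 := by
  have hl : 1 ≤ Real.log ν⁻¹ := by
    rw [Real.log_inv]
    have := Real.log_le_log hν hν1
    rw [Real.log_exp] at this
    linarith
  have hC1 : 1 ≤ C := by linarith
  set l := Real.log ν⁻¹ with hl'
  have hs : 0 < Real.sqrt l := Real.sqrt_pos.2 (by linarith)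
  have h1 : R * (C * Real.sqrt l) ≤ ν ^ (-(1 / 2) : ℝ) := (le_div_iff₀ (by positivity)).1 hRν
  have h2 : R ^ 2 * C ^ 2 * l ≤ ν⁻¹ := by
    have h3 := pow_le_pow_left₀ (by positivity) h1 2
    rw [← Real.rpow_natCast (ν ^ (-(1 / 2) : ℝ)), ← Real.rpow_mul hν.le, mul_pow, mul_pow,
      Real.sq_sqrt (by linarith)] at h3
    norm_num at h3
    rw [Real.rpow_neg_one] at h3
    linarith
  have h3 : ν * R ^ 2 * l * C ^ 2 ≤ 1 := by
    have := mul_le_mul_of_nonneg_left h2 hν.le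
    rw [mul_inv_cancel₀ hν.ne'] at this
    linarith
  have h4 : 2 * Real.log R ≤ l := by
    have h5 : R ^ 2 ≤ ν⁻¹ := by
      refine le_trans ?_ h2
      rw [mul_assoc]
      exact le_mul_of_one_le_right (by positivity)
        (one_le_mul_of_one_le_of_one_le (one_le_pow₀ hC1) hl)
    have h6 := Real.log_le_log (by positivity) h5
    rw [Real.log_pow] at h6
    exact_mod_cast h6
  have hπ : π ^ 2 ≤ 10 := by nlinarith [Real.pi_gt_three, Real.pi_lt_d2]
  have h5 : ν * R ^ 2 * l ≤ 1 / C ^ 2 := by rwa [le_div_iff₀ (by positivity)]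
  have h6 : 1280 * B ≤ C ^ 2 := by nlinarith
  have hlR : 0 ≤ Real.log R := Real.log_nonneg (by linarith)
  calc _ ≤ 8 * 10 * ν * (2 * R) ^ 2 * (B * (l / 2)) := by
        gcongr
        linarith
    _ = 160 * B * (ν * R ^ 2 * l) := by ring
    _ ≤ 160 * B * (1 / C ^ 2) := by gcongr
    _ ≤ 1 / 8 := by
        rw [mul_one_div, div_le_iff₀ (by positivity)]
        linarith

theorem log_le_two_mul_log_div {N R : ℝ} (hN : 0 < N) (hR : 0 < R) (h : N ^ 2 ≤ R) :
    Real.log R ≤ 2 * Real.log (R / N) := by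
  have := Real.log_le_log (by positivity) h
  rw [Real.log_pow] at this
  rw [Real.log_div hR.ne' hN.ne']
  push_cast at this
  linarith

theorem undercharged_coeff_le {C B h α q : ℝ} (hB : 0 ≤ B) (hC : 1000 * (1 + B) ≤ C) (hh : 1 ≤ h)
    (hα : 0 < α) (hq : 2 ≤ q) :
    B * (32 * π * (1 / (192 * π * α) * (2 * (1 + h / 3) ^ (1 - q)))) ≤
      C ^ q * h ^ (2 - q) / α := by
  have h1 : (1 + h / 3) ^ (1 - q) ≤ (h / 3) ^ (1 - q) :=
    Real.rpow_le_rpow_of_nonpos (by positivity) (by linarith) (by linarith)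
  have h2 : (h / 3) ^ (1 - q) = 3 ^ (q - 1) * h ^ (1 - q) := by
    rw [Real.div_rpow (by positivity) (by norm_num), div_eq_mul_inv,
      ← Real.rpow_neg (by norm_num), neg_sub, mul_comm]
  have h3 : h ^ (1 - q) ≤ h ^ (2 - q) := Real.rpow_le_rpow_of_exponent_le hh (by linarith)
  have h4 : B * 3 ^ (q - 1) ≤ C ^ q := by
    have hCq : C ^ q = C * C ^ (q - 1) := by
      rw [← Real.rpow_one_add' (by linarith) (by linarith)]
      congr 1
      ring
    rw [hCq]
    gcongr <;> linarith
  have hC0 : 0 ≤ C := by linarith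
  calc _ ≤ B * (32 * π * (1 / (192 * π * α) * (2 * (3 ^ (q - 1) * h ^ (2 - q))))) := by
        gcongr
        rw [← h2.symm] at h1
        exact h1.trans (by gcongr)
    _ = (B * 3 ^ (q - 1)) * h ^ (2 - q) / α / 3 := by
        field_simp
        ring
    _ ≤ (B * 3 ^ (q - 1)) * h ^ (2 - q) / α := div_le_self (by positivity) (by norm_num)
    _ ≤ _ := by gcongr

theorem moment_coeff_le {C B α q p : ℝ} (hB : 0 ≤ B) (hC : 1000 * (1 + B) ≤ C)
    (hα : 0 < α) (hq : 0 ≤ q) (hp : 1 ≤ p) :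
    B * (32 * π * ((192 * π * α) ^ (p - 1) * 2)) ≤ C ^ (p + q) * α ^ (p - 1) := by
  have hπ := Real.pi_lt_d2
  have hC1 : 1 ≤ C := by linarith
  have h1 : C * C ^ (p - 1) ≤ C ^ (p + q) := by
    rw [← Real.rpow_one_add' (by linarith) (by linarith)]
    exact Real.rpow_le_rpow_of_exponent_le hC1 (by linarith)
  have h2 : B * (64 * π) ≤ C := by nlinarith
  calc _ = B * (64 * π) * ((192 * π) ^ (p - 1) * α ^ (p - 1)) := by
        rw [Real.mul_rpow (by positivity) hα.le]
        ring
    _ ≤ C * (C ^ (p - 1) * α ^ (p - 1)) := by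
        gcongr
        linarith
    _ ≤ _ := by
        rw [← mul_assoc]
        gcongr

section Probability

variable {d : ℕ} {Ω : Type*} [MeasurableSpace Ω] {ℙ : Measure Ω} {ν K γ q : ℝ}
  {v : Ω → ℝ → (Fin d → ℤ) → Fin d → ℂ} {a : Ω → ℝ → (Fin d → ℤ) → ℂ} {g : (Fin d → ℤ) → ℂ}

theorem measurable_cnorm : Measurable (cnorm : (Fin d → ℂ) → ℝ) := by
  unfold cnorm
  fun_prop

namespace AdvectionSetup

theorem measurable_sq (S : AdvectionSetup ℙ ν K γ v a g) (k : Fin d → ℤ) :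
    Measurable fun x : Ω × ℝ => (‖a x.1 x.2 k‖₊ : ℝ≥0∞) ^ 2 :=
  (S.1 k).nnnorm.coe_nnreal_ennreal.pow_const 2

theorem measurable_polyNorm (S : AdvectionSetup ℙ ν K γ v a g) (q : ℝ) :
    Measurable fun x : Ω × ℝ => polyNorm q (v x.1 x.2) := by
  unfold polyNorm
  refine Measurable.tsum fun k => ENNReal.measurable_ofReal.comp (Measurable.const_mul ?_ _)
  exact measurable_cnorm.comp (measurable_pi_iff.2 (S.2.1 k))

theorem ae_isPath (S : AdvectionSetup ℙ ν K γ v a g)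
    (hint : ∀ᵐ ω ∂ℙ, ∀ T > (0 : ℝ), ∫⁻ t in Icc 0 T, polyNorm q (v ω t) ≠ ⊤) :
    ∀ᵐ ω ∂ℙ, a ω 0 = g ∧ IsPath ν q (v ω) (a ω) := by
  filter_upwards [S.2.2.2.2.1, hint] with ω ⟨h1, h2, h3, h4⟩ h5
  have hm : Measurable fun t => polyNorm q (v ω t) :=
    Measurable.of_uncurry_left (f := fun ω t => polyNorm q (v ω t)) (S.measurable_polyNorm q)
  exact ⟨h2, h1, h3, h4, hm, h5⟩

theorem half_le_flux [IsProbabilityMeasure ℙ] (S : AdvectionSetup ℙ ν K γ v a g)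
    (hpath : ∀ᵐ ω ∂ℙ, a ω 0 = g ∧ IsPath ν q (v ω) (a ω)) (hν : 0 ≤ ν) (hq : 2 ≤ q)
    (hne : ∃ s : ℝ, 1 ≤ s ∧ massOn g (Set.Ici s) ≤ ENNReal.ofReal (1 / 4)) {r T : ℝ}
    (hr0 : 0 ≤ r) (hr : sInf {s : ℝ | 1 ≤ s ∧ massOn g (Set.Ici s) ≤ ENNReal.ofReal (1 / 4)} < r)
    (hT : 0 < T) (hmix : (2 * π * r) ^ 2 * (K * Real.exp (-γ * T)) ≤ 1 / 8)
    (hdiff : 8 * π ^ 2 * ν * r ^ 2 * T ≤ 1 / 8) :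
    ENNReal.ofReal (1 / 2) ≤ ENNReal.ofReal (4 * π * r) *
      ∫⁻ x, polyNorm q (v x.1 x.2) * polyMass q (a x.1 x.2) r
        ∂(ℙ.prod (volume.restrict (Icc 0 T))) := by
  have hprod : Measurable fun x : Ω × ℝ => polyNorm q (v x.1 x.2) * polyMass q (a x.1 x.2) r :=
    (S.measurable_polyNorm q).mul
      (Measurable.tsum fun k => (S.measurable_sq k).const_mul _)
  rw [lintegral_prod _ hprod.aemeasurable]
  set J : Ω → ℝ≥0∞ := fun ω =>
    ∫⁻ t in Icc 0 T, polyNorm q (v ω t) * polyMass q (a ω t) r with hJ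
  have hJm : Measurable J := hprod.lintegral_prod_right'
  set X : Ω → ℝ≥0∞ := fun ω => ∑ k ∈ zball d r, (‖a ω T k‖₊ : ℝ≥0∞) ^ 2 with hX
  have hXm : Measurable X :=
    Finset.measurable_fun_sum _ fun k _ => (S.measurable_sq k).comp measurable_prodMk_right
  have hXint : ∫⁻ ω, X ω ∂ℙ ≤ ENNReal.ofReal (1 / 8) := by
    calc ∫⁻ ω, X ω ∂ℙ ≤ ∫⁻ ω, ENNReal.ofReal ((2 * π * r) ^ 2) *
          ∑' k : Fin d → ℤ, (if k = 0 then 0 else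
            (ENNReal.ofReal ((2 * π * znorm k) ^ 2))⁻¹ * (‖a ω T k‖₊ : ℝ≥0∞) ^ 2) ∂ℙ := by
          refine lintegral_mono_ae ?_
          filter_upwards [hpath] with ω ⟨h0, h⟩
          exact sum_zball_le (h.apply_zero_eq (by rw [h0]; exact S.2.2.1) hT.le) r
      _ ≤ ENNReal.ofReal ((2 * π * r) ^ 2) * ENNReal.ofReal (K * Real.exp (-γ * T)) := by
          rw [lintegral_const_mul' _ _ ENNReal.ofReal_ne_top]
          gcongr
          exact S.2.2.2.2.2 T hT.le
      _ ≤ _ := by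
          rw [← ENNReal.ofReal_mul (by positivity)]
          exact ENNReal.ofReal_le_ofReal hmix
  have hmain : ENNReal.ofReal (3 / 4) ≤ ENNReal.ofReal (1 / 8) +
      (ENNReal.ofReal (1 / 8) + ENNReal.ofReal (4 * π * r) * ∫⁻ ω, J ω ∂ℙ) := by
    calc ENNReal.ofReal (3 / 4) = ∫⁻ _, ENNReal.ofReal (3 / 4) ∂ℙ := by simp
      _ ≤ ∫⁻ ω, (X ω + (ENNReal.ofReal (1 / 8) + ENNReal.ofReal (4 * π * r) * J ω)) ∂ℙ := by
          refine lintegral_mono_ae ?_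
          filter_upwards [hpath] with ω ⟨h0, h⟩
          refine (three_quarters_le_sum_zball S.2.2.2.1 hne hr).trans ?_
          have := h.sum_initial_le hν hq (by rw [h0]; exact S.2.2.2.1) hr0 hT
          rw [h0] at this
          exact this.trans (by gcongr)
      _ = ∫⁻ ω, X ω ∂ℙ + (ENNReal.ofReal (1 / 8) +
            ENNReal.ofReal (4 * π * r) * ∫⁻ ω, J ω ∂ℙ) := by
          rw [lintegral_add_left hXm, lintegral_add_left measurable_const,
            lintegral_const_mul _ hJm, lintegral_const, measure_univ, mul_one]
      _ ≤ _ := by gcongr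
  rw [← add_assoc, ← ENNReal.ofReal_add (by norm_num) (by norm_num),
    show (3 / 4 : ℝ) = (1 / 8 + 1 / 8) + 1 / 2 by norm_num,
    ENNReal.ofReal_add (by norm_num) (by norm_num)] at hmain
  exact (ENNReal.add_le_add_iff_left ENNReal.ofReal_ne_top).1 hmain

theorem lintegral_massOn_le_asymMass [SFinite ℙ] (S : AdvectionSetup ℙ ν K γ v a g) (T : ℝ)
    (E : Set ℝ) :
    ∫⁻ x, (∑' k, if znorm k ∈ E then (‖a x.1 x.2 k‖₊ : ℝ≥0∞) ^ 2 else 0)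
      ∂(ℙ.prod (volume.restrict (Icc 0 T))) ≤ asymMass ℙ a E := by
  have hm : Measurable fun x : Ω × ℝ =>
      ∑' k, if znorm k ∈ E then (‖a x.1 x.2 k‖₊ : ℝ≥0∞) ^ 2 else 0 :=
    Measurable.tsum fun k => by
      split_ifs
      exacts [S.measurable_sq k, measurable_const]
  rw [lintegral_prod _ hm.aemeasurable]
  exact lintegral_mono fun ω => lintegral_mono_set Icc_subset_Ici_self

theorem lintegral_polyNorm_rpow_le [SFinite ℙ] (S : AdvectionSetup ℙ ν K γ v a g) {T p : ℝ}
    {M : ℝ≥0∞} (hM : ∀ t, 0 ≤ t → ∫⁻ ω, polyNorm q (v ω t) ^ p ∂ℙ ≤ M) :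
    ∫⁻ x, polyNorm q (v x.1 x.2) ^ p ∂(ℙ.prod (volume.restrict (Icc 0 T))) ≤
      ENNReal.ofReal T * M := by
  rw [lintegral_prod_symm _ ((S.measurable_polyNorm q).pow_const p).aemeasurable]
  calc _ ≤ ∫⁻ _ in Icc 0 T, M := setLIntegral_mono' measurableSet_Icc fun t ht => hM t ht.1
    _ = _ := by rw [setLIntegral_const, Real.volume_Icc, sub_zero, mul_comm]

theorem ae_tsum_le_one [SFinite ℙ] (S : AdvectionSetup ℙ ν K γ v a g)
    (hpath : ∀ᵐ ω ∂ℙ, a ω 0 = g ∧ IsPath ν q (v ω) (a ω)) (hν : 0 ≤ ν) (hq : 2 ≤ q) (T : ℝ) :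
    ∀ᵐ x ∂(ℙ.prod (volume.restrict (Icc 0 T))), ∑' k, (‖a x.1 x.2 k‖₊ : ℝ≥0∞) ^ 2 ≤ 1 := by
  rw [Measure.ae_prod_iff_ae_ae
    (measurableSet_le (Measurable.tsum fun k => S.measurable_sq k) measurable_const)]
  filter_upwards [hpath] with ω ⟨h0, h⟩
  filter_upwards [ae_restrict_mem measurableSet_Icc] with t ht
  exact h.tsum_le_one hν hq (by rw [h0]; exact S.2.2.2.1) ht.1

end AdvectionSetup

end Probability

/-- the general density bound for undercharged annuli, with moment bounds
on the weighted-ℓ¹ norm `W_t = Σ_k (1+|k|)^q |v_t(k)|` of the velocity. -/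
theorem general_density_bound (d : ℕ) (hd : 1 ≤ d)
    (K γ N₀ : ℝ) (hK : 1 ≤ K) (hγ : 0 < γ) :
    ∃ C : ℝ, 2 ≤ C ∧
      ∀ (ν : ℝ), 0 < ν → ν ≤ Real.exp (-1) →
      ∀ (Ω : Type) [MeasurableSpace Ω] (ℙ : Measure Ω) [IsProbabilityMeasure ℙ]
        (v : Ω → ℝ → (Fin d → ℤ) → Fin d → ℂ) (a : Ω → ℝ → (Fin d → ℤ) → ℂ)
        (g : (Fin d → ℤ) → ℂ) (q p : ℝ), 2 ≤ q → 2 ≤ p →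
      AdvectionSetup ℙ ν K γ v a g →
      N₀ = sInf {s : ℝ | 1 ≤ s ∧ massOn g (Set.Ici s) ≤ ENNReal.ofReal (1 / 4)} →
      (∃ s : ℝ, 1 ≤ s ∧ massOn g (Set.Ici s) ≤ ENNReal.ofReal (1 / 4)) →
      (∀ᵐ ω ∂ℙ, ∀ T > (0 : ℝ),
        (∫⁻ t in Set.Icc (0 : ℝ) T,
          ∑' k : Fin d → ℤ, ENNReal.ofReal ((1 + znorm k) ^ q * cnorm (v ω t k))) ≠ ⊤) →
      (∀ t : ℝ, 0 ≤ t →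
        (∫⁻ ω, (∑' k : Fin d → ℤ, ENNReal.ofReal ((1 + znorm k) ^ q * cnorm (v ω t k))) ^ p ∂ℙ)
          ≤ ∫⁻ ω, (∑' k : Fin d → ℤ, ENNReal.ofReal ((1 + znorm k) ^ q * cnorm (v ω 0 k))) ^ p ∂ℙ) →
      (∫⁻ ω, (∑' k : Fin d → ℤ, ENNReal.ofReal ((1 + znorm k) ^ q * cnorm (v ω 0 k))) ^ p ∂ℙ) ≠ ⊤ →
      ∀ h R α : ℝ, 1 ≤ h → max C h ≤ R →
        R ≤ ν ^ (-(1 / 2) : ℝ) / (C * Real.sqrt (Real.log ν⁻¹)) → 0 < α →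
        logDensity N₀ R {r : ℝ | h ≤ r ∧ r ≤ R ∧
            asymMass ℙ a (Set.Icc r (r + h)) ≤ ENNReal.ofReal (α * h / r)}
          ≤ ENNReal.ofReal (C ^ q * h ^ (2 - q) / α)
            + ENNReal.ofReal (C ^ (p + q)) *
              (∫⁻ ω, (∑' k : Fin d → ℤ,
                ENNReal.ofReal ((1 + znorm k) ^ q * cnorm (v ω 0 k))) ^ p ∂ℙ) *
              ENNReal.ofReal (α ^ (p - 1)) := by
  set L : ℝ := Real.log (128 * π ^ 2 * K) / Real.log 2 + 2 with hL
  have hL0 : 0 < L := by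
    have : 0 ≤ Real.log (128 * π ^ 2 * K) := Real.log_nonneg (by nlinarith [Real.pi_gt_three])
    have := Real.log_pos one_lt_two
    positivity
  set B : ℝ := L / γ with hB
  have hB0 : 0 < B := by positivity
  set C : ℝ := 1000 * (1 + 2 * B) + N₀ ^ 2 with hC
  have hCB : 1000 * (1 + 2 * B) ≤ C := by linarith [sq_nonneg N₀]
  refine ⟨C, by linarith, ?_⟩
  intro ν hν hν1 Ω _ ℙ _ v a g q p hq hp S hN hne hint hmom _ h R α hh hR hRν hα
  have hCR : C ≤ R := (le_max_left _ _).trans hR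
  have hR2 : 2 ≤ R := by linarith
  have hN1 : 1 ≤ N₀ := hN ▸ le_csInf hne fun s hs => hs.1
  have hpath := S.ae_isPath (q := q) hint
  set T : ℝ := B * Real.log R with hT
  have hlogR : 0 < Real.log R := Real.log_pos (by linarith)
  have hT0 : 0 < T := by positivity
  have hlog := log_le_two_mul_log_div (N := N₀) (R := R) (by linarith) (by linarith)
    (by linarith)
  have hlog0 : 0 < Real.log (R / N₀) := by linarith
  set M : ℝ≥0∞ := ∫⁻ ω, (∑' k : Fin d → ℤ,
    ENNReal.ofReal ((1 + znorm k) ^ q * cnorm (v ω 0 k))) ^ p ∂ℙ with hM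
  have key := lintegral_undercharged_le (P := ℙ.prod (volume.restrict (Icc 0 T)))
    (n := znorm) S.measurable_sq (S.ae_tsum_le_one hpath hν.le hq T) (S.measurable_polyNorm q)
    (N₀ := N₀) (R := R) hq (by linarith : 1 ≤ p) hh hα fun r hr hrR =>
      S.half_le_flux hpath hν.le hq hne (by linarith) (hN ▸ hr) hT0
        (mixing_scale_le hK hγ hR2 (by linarith) hrR)
        (diffusion_scale_le hν hν1 hR2 hB0.le hCB hRν (by linarith) hrR)
  have hTlog : (ENNReal.ofReal (Real.log (R / N₀)))⁻¹ * ENNReal.ofReal T ≤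
      ENNReal.ofReal (2 * B) := by
    rw [← ENNReal.ofReal_inv_of_pos hlog0, ← ENNReal.ofReal_mul (by positivity)]
    refine ENNReal.ofReal_le_ofReal ?_
    rw [inv_mul_le_iff₀ hlog0, hT]
    nlinarith
  have hPuniv : ℙ.prod (volume.restrict (Icc 0 T)) univ = ENNReal.ofReal T := by
    rw [← univ_prod_univ, Measure.prod_prod, measure_univ, one_mul, Measure.restrict_apply_univ,
      Real.volume_Icc, sub_zero]
  rw [hPuniv] at key
  calc _ ≤ (ENNReal.ofReal (Real.log (R / N₀)))⁻¹ *
        (ENNReal.ofReal (32 * π) * (ENNReal.ofReal (1 / (192 * π * α)) *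
          ENNReal.ofReal (2 * (1 + h / 3) ^ (1 - q)) * ENNReal.ofReal T +
          ENNReal.ofReal ((192 * π * α) ^ (p - 1)) * 2 * (ENNReal.ofReal T * M))) := by
        refine mul_le_mul_right ?_ _
        refine le_trans (lintegral_mono_set ?_) (key.trans ?_)
        · refine inter_subset_inter_left _ fun r hr => ⟨hr.1, hr.2.1, ?_⟩
          refine le_of_eq_of_le ?_ ((S.lintegral_massOn_le_asymMass T _).trans hr.2.2)
          congr!
        · gcongr
          exact S.lintegral_polyNorm_rpow_le hmom
    _ = (ENNReal.ofReal (Real.log (R / N₀)))⁻¹ * ENNReal.ofReal T *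
          (ENNReal.ofReal (32 * π) * (ENNReal.ofReal (1 / (192 * π * α)) *
            ENNReal.ofReal (2 * (1 + h / 3) ^ (1 - q)))) +
        (ENNReal.ofReal (Real.log (R / N₀)))⁻¹ * ENNReal.ofReal T *
          (ENNReal.ofReal (32 * π) * (ENNReal.ofReal ((192 * π * α) ^ (p - 1)) * 2)) * M := by
        ring
    _ ≤ ENNReal.ofReal (2 * B) *
          (ENNReal.ofReal (32 * π) * (ENNReal.ofReal (1 / (192 * π * α)) *
            ENNReal.ofReal (2 * (1 + h / 3) ^ (1 - q)))) +
        ENNReal.ofReal (2 * B) *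
          (ENNReal.ofReal (32 * π) * (ENNReal.ofReal ((192 * π * α) ^ (p - 1)) * 2)) * M := by
        gcongr
    _ ≤ ENNReal.ofReal (C ^ q * h ^ (2 - q) / α) +
        ENNReal.ofReal (C ^ (p + q) * α ^ (p - 1)) * M := by
        gcongr
        · rw [← ENNReal.ofReal_mul (by positivity), ← ENNReal.ofReal_mul (by positivity),
            ← ENNReal.ofReal_mul (by positivity)]
          exact ENNReal.ofReal_le_ofReal
            (undercharged_coeff_le (by positivity) hCB hh hα hq)
        · rw [← ENNReal.ofReal_ofNat 2, ← ENNReal.ofReal_mul (by positivity),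
            ← ENNReal.ofReal_mul (by positivity), ← ENNReal.ofReal_mul (by positivity)]
          exact ENNReal.ofReal_le_ofReal
            (moment_coeff_le (by positivity) hCB hα (by linarith) (by linarith))
    _ = _ := by
        rw [ENNReal.ofReal_mul (by positivity)]
        ring
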